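/- arXiv:2508.07509 — 5 statements merged into one kernel-verified Lean document; each statement's English description precedes it below -/
import Mathlib

section
/- Normal form: for every formula φ of PL(∨∨) and every team t, t ⊨ φ if and only if t ⊨ α for some resolution α ∈ R(φ). Moreover, for every finite multiset Γ of PL(∨∨) formulas and every team t, t ⊨ Γ if and only if t ⊨ Ξ for some Ξ ∈ R(Γ). -/
/-! Basic propositional team logic PL(∨∨): syntax, team semantics,
resolutions, and the sequent calculi GT, G3cp, GT'. -/

/-- Valuations over a countably infinite set of propositional variables (ℕ). -/
abbrev Val : Type := ℕ → Bool

/-- A team is a set of valuations. -/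
abbrev Team : Type := Set Val

/-- Formulas; PL(∨∨) formulas are the well-formed (`WF`) ones, in which
negation is applied only to classical formulas. `disj` is the split
disjunction ∨ and `idisj` the inquisitive disjunction ∨∨. -/
inductive Form : Type where
  | var : ℕ → Form
  | bot : Form
  | neg : Form → Form
  | conj : Form → Form → Form
  | disj : Form → Form → Form
  | idisj : Form → Form → Form

namespace Form

/-- Classical (CPL) formulas: no inquisitive disjunction. -/
def IsClassical : Form → Prop
  | var _ => True
  | bot => True
  | neg α => IsClassical α
  | conj α β => IsClassical α ∧ IsClassical β
  | disj α β => IsClassical α ∧ IsClassical β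
  | idisj _ _ => False

/-- Well-formed formulas = formulas of PL(∨∨): negation applies only to
classical formulas. -/
def WF : Form → Prop
  | var _ => True
  | bot => True
  | neg α => IsClassical α
  | conj φ ψ => WF φ ∧ WF ψ
  | disj φ ψ => WF φ ∧ WF ψ
  | idisj φ ψ => WF φ ∧ WF ψ

/-- Team satisfaction. -/
def Sat : Form → Team → Prop
  | var p, t => ∀ v ∈ t, v p = true
  | bot, t => t = ∅
  | neg α, t => ∀ v ∈ t, ¬ Sat α {v}
  | conj φ ψ, t => Sat φ t ∧ Sat ψ t
  | disj φ ψ, t => ∃ s u : Team, t = s ∪ u ∧ Sat φ s ∧ Sat ψ u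
  | idisj φ ψ, t => Sat φ t ∨ Sat ψ t

/-- Single-valuation (classical) satisfaction, for classical formulas. -/
def CSat : Form → Val → Prop
  | var p, v => v p = true
  | bot, _ => False
  | neg α, v => ¬ CSat α v
  | conj α β, v => CSat α v ∧ CSat β v
  | disj α β, v => CSat α v ∨ CSat β v
  | idisj _ _, _ => False

/-- The set of resolutions of a formula. -/
def res : Form → Set Form
  | var p => {var p}
  | bot => {bot}
  | neg α => Form.neg '' res α
  | conj φ ψ => Set.image2 Form.conj (res φ) (res ψ)
  | disj φ ψ => Set.image2 Form.disj (res φ) (res ψ)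
  | idisj φ ψ => res φ ∪ res ψ

/-- Propositional variables occurring in a formula. -/
def vars : Form → Set ℕ
  | var p => {p}
  | bot => ∅
  | neg α => vars α
  | conj φ ψ => vars φ ∪ vars ψ
  | disj φ ψ => vars φ ∪ vars ψ
  | idisj φ ψ => vars φ ∪ vars ψ

/-- Signed occurrences: `svars φ true` = positively occurring variables,
`svars φ false` = negatively occurring variables. -/
def svars : Form → Bool → Set ℕ
  | var p, b => if b then {p} else ∅
  | bot, _ => ∅
  | neg α, b => svars α (!b)
  | conj φ ψ, b => svars φ b ∪ svars ψ b
  | disj φ ψ, b => svars φ b ∪ svars ψ b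
  | idisj φ ψ, b => svars φ b ∪ svars ψ b

/-- Positively occurring variables P⁺(φ). -/
def pvars (φ : Form) : Set ℕ := φ.svars true

/-- Negatively occurring variables P⁻(φ). -/
def nvars (φ : Form) : Set ℕ := φ.svars false

end Form

/-- `t ⊨ Γ`: every formula of the multiset Γ is satisfied by `t`. -/
def SatAll (t : Team) (Γ : Multiset Form) : Prop := ∀ φ ∈ Γ, Form.Sat φ t

/-- Team entailment Γ ⊨ φ. -/
def Entails (Γ : Multiset Form) (φ : Form) : Prop :=
  ∀ t : Team, SatAll t Γ → Form.Sat φ t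

/-- Resolutions R(Γ) of a multiset of formulas: images of Γ under resolution
functions. -/
def mres (Γ : Multiset Form) : Set (Multiset Form) :=
  {Ξ | ∃ f : Form → Form, (∀ φ ∈ Γ, f φ ∈ Form.res φ) ∧ Ξ = Γ.map f}

/-- Variables occurring in a multiset of formulas. -/
def mvars (Γ : Multiset Form) : Set ℕ := {p | ∃ φ ∈ Γ, p ∈ Form.vars φ}

/-- P⁺(Γ). -/
def mpvars (Γ : Multiset Form) : Set ℕ := {p | ∃ φ ∈ Γ, p ∈ Form.pvars φ}

/-- P⁻(Γ). -/
def mnvars (Γ : Multiset Form) : Set ℕ := {p | ∃ φ ∈ Γ, p ∈ Form.nvars φ}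

/-- The split disjunction ⋁Δ of a multiset (⊥ for the empty multiset).
(Satisfaction is invariant under the order of the chosen list.) -/
noncomputable def bigVee (Δ : Multiset Form) : Form :=
  Δ.toList.foldr Form.disj Form.bot

/-- One-hole formula contexts in which the hole does not occur in the scope
of a negation; these represent the subformula occurrences to which the
deep-inference rules may be applied. -/
inductive Ctx : Type where
  | hole : Ctx
  | conjL : Ctx → Form → Ctx
  | conjR : Form → Ctx → Ctx
  | disjL : Ctx → Form → Ctx
  | disjR : Form → Ctx → Ctx
  | idisjL : Ctx → Form → Ctx
  | idisjR : Form → Ctx → Ctx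

/-- Plugging a formula into a context: χ{η}. -/
def Ctx.fill : Ctx → Form → Form
  | .hole, η => η
  | .conjL c ψ, η => Form.conj (c.fill η) ψ
  | .conjR ψ c, η => Form.conj ψ (c.fill η)
  | .disjL c ψ, η => Form.disj (c.fill η) ψ
  | .disjR ψ c, η => Form.disj ψ (c.fill η)
  | .idisjL c ψ, η => Form.idisj (c.fill η) ψ
  | .idisjR ψ c, η => Form.idisj ψ (c.fill η)

/-- The sequent calculus GT. `GT c n Γ Δ` means: the sequent Γ ⇒ Δ has a
derivation of height at most `n`, using Cut only if `c = true`.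
So `∃ n, GT true n Γ Δ` is derivability in GT, `∃ n, GT false n Γ Δ` is
derivability in the cut-free fragment GT⁻, and `GT false n Γ Δ` is
`⊢ⁿ Γ ⇒ Δ` (cut-free derivability with height at most n). -/
inductive GT : Bool → ℕ → Multiset Form → Multiset Form → Prop
  | ax (c : Bool) (n : ℕ) (Γ Δ : Multiset Form) (p : ℕ) :
      GT c (n + 1) (Form.var p ::ₘ Γ) (Form.var p ::ₘ Δ)
  | lbot (c : Bool) (n : ℕ) (Γ Δ : Multiset Form) :
      GT c (n + 1) (Form.bot ::ₘ Γ) Δ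
  | lneg (c : Bool) (n : ℕ) (Γ Δ : Multiset Form) (α : Form) :
      Form.IsClassical α → GT c n Γ (α ::ₘ Δ) →
      GT c (n + 1) (Form.neg α ::ₘ Γ) Δ
  | rneg (c : Bool) (n : ℕ) (Γ Δ : Multiset Form) (α : Form) :
      Form.IsClassical α → GT c n (α ::ₘ Γ) Δ →
      GT c (n + 1) Γ (Form.neg α ::ₘ Δ)
  | lconj (c : Bool) (n : ℕ) (Γ Δ : Multiset Form) (φ ψ : Form) :
      GT c n (φ ::ₘ ψ ::ₘ Γ) Δ →
      GT c (n + 1) (Form.conj φ ψ ::ₘ Γ) Δ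
  | rconj (c : Bool) (n : ℕ) (Γ Λ Δ : Multiset Form) (φ ψ : Form) :
      (∀ γ ∈ Λ, Form.IsClassical γ) →
      GT c n Γ (φ ::ₘ Λ) → GT c n Γ (ψ ::ₘ Λ) →
      GT c (n + 1) Γ (Form.conj φ ψ ::ₘ (Λ + Δ))
  | ldisj (c : Bool) (n : ℕ) (Γ Λ Δ : Multiset Form) (φ ψ : Form) :
      (∀ γ ∈ Λ, Form.IsClassical γ) →
      GT c n (φ ::ₘ Γ) Λ → GT c n (ψ ::ₘ Γ) Λ →
      GT c (n + 1) (Form.disj φ ψ ::ₘ Γ) (Λ + Δ)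
  | rdisj (c : Bool) (n : ℕ) (Γ Δ : Multiset Form) (φ ψ : Form) :
      GT c n Γ (φ ::ₘ ψ ::ₘ Δ) →
      GT c (n + 1) Γ (Form.disj φ ψ ::ₘ Δ)
  | lidisj (c : Bool) (n : ℕ) (Γ Δ : Multiset Form) (χ : Ctx) (φL φR : Form) :
      GT c n (χ.fill φL ::ₘ Γ) Δ → GT c n (χ.fill φR ::ₘ Γ) Δ →
      GT c (n + 1) (χ.fill (Form.idisj φL φR) ::ₘ Γ) Δ
  | ridisjL (c : Bool) (n : ℕ) (Γ Δ : Multiset Form) (χ : Ctx) (φL φR : Form) :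
      GT c n Γ (χ.fill φL ::ₘ Δ) →
      GT c (n + 1) Γ (χ.fill (Form.idisj φL φR) ::ₘ Δ)
  | ridisjR (c : Bool) (n : ℕ) (Γ Δ : Multiset Form) (χ : Ctx) (φL φR : Form) :
      GT c n Γ (χ.fill φR ::ₘ Δ) →
      GT c (n + 1) Γ (χ.fill (Form.idisj φL φR) ::ₘ Δ)
  | cut (n : ℕ) (Γ Δ Θ S : Multiset Form) (φ : Form) :
      GT true n Γ (φ ::ₘ Δ) → GT true n (φ ::ₘ Θ) S →
      GT true (n + 1) (Γ + Θ) (Δ + S)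

/-- The classical sequent calculus G3cp (on classical formulas).
`G3 false` is its cut-free fragment G3cp⁻. -/
inductive G3 : Bool → Multiset Form → Multiset Form → Prop
  | ax (c : Bool) (Γ Δ : Multiset Form) (p : ℕ) :
      (∀ α ∈ Γ, Form.IsClassical α) → (∀ α ∈ Δ, Form.IsClassical α) →
      G3 c (Form.var p ::ₘ Γ) (Form.var p ::ₘ Δ)
  | lbot (c : Bool) (Γ Δ : Multiset Form) :
      (∀ α ∈ Γ, Form.IsClassical α) → (∀ α ∈ Δ, Form.IsClassical α) →
      G3 c (Form.bot ::ₘ Γ) Δ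
  | lneg (c : Bool) (Γ Δ : Multiset Form) (α : Form) :
      Form.IsClassical α → G3 c Γ (α ::ₘ Δ) → G3 c (Form.neg α ::ₘ Γ) Δ
  | rneg (c : Bool) (Γ Δ : Multiset Form) (α : Form) :
      Form.IsClassical α → G3 c (α ::ₘ Γ) Δ → G3 c Γ (Form.neg α ::ₘ Δ)
  | lconj (c : Bool) (Γ Δ : Multiset Form) (α β : Form) :
      G3 c (α ::ₘ β ::ₘ Γ) Δ → G3 c (Form.conj α β ::ₘ Γ) Δ
  | rconj (c : Bool) (Γ Λ Δ : Multiset Form) (α β : Form) :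
      (∀ γ ∈ Λ, Form.IsClassical γ) → (∀ γ ∈ Δ, Form.IsClassical γ) →
      G3 c Γ (α ::ₘ Λ) → G3 c Γ (β ::ₘ Λ) →
      G3 c Γ (Form.conj α β ::ₘ (Λ + Δ))
  | ldisj (c : Bool) (Γ Λ Δ : Multiset Form) (α β : Form) :
      (∀ γ ∈ Λ, Form.IsClassical γ) → (∀ γ ∈ Δ, Form.IsClassical γ) →
      G3 c (α ::ₘ Γ) Λ → G3 c (β ::ₘ Γ) Λ →
      G3 c (Form.disj α β ::ₘ Γ) (Λ + Δ)
  | rdisj (c : Bool) (Γ Δ : Multiset Form) (α β : Form) :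
      G3 c Γ (α ::ₘ β ::ₘ Δ) → G3 c Γ (Form.disj α β ::ₘ Δ)
  | cut (Γ Δ Θ S : Multiset Form) (α : Form) :
      Form.IsClassical α →
      G3 true Γ (α ::ₘ Δ) → G3 true (α ::ₘ Θ) S →
      G3 true (Γ + Θ) (Δ + S)

/-- The cut-free variant calculus GT'⁻: GT⁻ with independent-context rules
R∧', L∨' in place of R∧, L∨, plus explicit contraction rules LC and RC
(RC restricted to classical formulas). -/
inductive GTp : Multiset Form → Multiset Form → Prop
  | ax (Γ Δ : Multiset Form) (p : ℕ) :
      GTp (Form.var p ::ₘ Γ) (Form.var p ::ₘ Δ)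
  | lbot (Γ Δ : Multiset Form) : GTp (Form.bot ::ₘ Γ) Δ
  | lneg (Γ Δ : Multiset Form) (α : Form) :
      Form.IsClassical α → GTp Γ (α ::ₘ Δ) → GTp (Form.neg α ::ₘ Γ) Δ
  | rneg (Γ Δ : Multiset Form) (α : Form) :
      Form.IsClassical α → GTp (α ::ₘ Γ) Δ → GTp Γ (Form.neg α ::ₘ Δ)
  | lconj (Γ Δ : Multiset Form) (φ ψ : Form) :
      GTp (φ ::ₘ ψ ::ₘ Γ) Δ → GTp (Form.conj φ ψ ::ₘ Γ) Δ
  | rconj (Γ₁ Γ₂ Δ₁ Δ₂ : Multiset Form) (φ ψ : Form) :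
      GTp Γ₁ (φ ::ₘ Δ₁) → GTp Γ₂ (ψ ::ₘ Δ₂) →
      GTp (Γ₁ + Γ₂) (Form.conj φ ψ ::ₘ (Δ₁ + Δ₂))
  | ldisj (Γ₁ Γ₂ Δ₁ Δ₂ : Multiset Form) (φ ψ : Form) :
      GTp (φ ::ₘ Γ₁) Δ₁ → GTp (ψ ::ₘ Γ₂) Δ₂ →
      GTp (Form.disj φ ψ ::ₘ (Γ₁ + Γ₂)) (Δ₁ + Δ₂)
  | rdisj (Γ Δ : Multiset Form) (φ ψ : Form) :
      GTp Γ (φ ::ₘ ψ ::ₘ Δ) → GTp Γ (Form.disj φ ψ ::ₘ Δ)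
  | lidisj (Γ Δ : Multiset Form) (χ : Ctx) (φL φR : Form) :
      GTp (χ.fill φL ::ₘ Γ) Δ → GTp (χ.fill φR ::ₘ Γ) Δ →
      GTp (χ.fill (Form.idisj φL φR) ::ₘ Γ) Δ
  | ridisjL (Γ Δ : Multiset Form) (χ : Ctx) (φL φR : Form) :
      GTp Γ (χ.fill φL ::ₘ Δ) → GTp Γ (χ.fill (Form.idisj φL φR) ::ₘ Δ)
  | ridisjR (Γ Δ : Multiset Form) (χ : Ctx) (φL φR : Form) :
      GTp Γ (χ.fill φR ::ₘ Δ) → GTp Γ (χ.fill (Form.idisj φL φR) ::ₘ Δ)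
  | lc (Γ Δ : Multiset Form) (φ : Form) :
      GTp (φ ::ₘ φ ::ₘ Γ) Δ → GTp (φ ::ₘ Γ) Δ
  | rc (Γ Δ : Multiset Form) (α : Form) :
      Form.IsClassical α → GTp Γ (α ::ₘ α ::ₘ Δ) → GTp Γ (α ::ₘ Δ)

/-- A classical formula is its own unique resolution. -/
theorem Form.IsClassical.res_eq_singleton {α : Form} (h : α.IsClassical) :
    α.res = {α} := by
  induction α with
  | var | bot => rfl
  | neg α ih => simp [Form.res, ih h]
  | conj α β ihα ihβ | disj α β ihα ihβ => simp [Form.res, ihα h.1, ihβ h.2]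
  | idisj => exact h.elim

/-- A team satisfies a formula iff it satisfies one of its resolutions. -/
theorem Form.WF.sat_iff_exists_res {φ : Form} (h : φ.WF) (t : Team) :
    φ.Sat t ↔ ∃ α ∈ φ.res, α.Sat t := by
  induction φ generalizing t with
  | var | bot => simp [Form.res]
  | neg α =>
    rw [Form.IsClassical.res_eq_singleton (α := .neg α) h]
    simp
  | conj φ ψ ihφ ihψ =>
    simp only [Form.res, Set.exists_mem_image2, Form.Sat, ihφ h.1, ihψ h.2]
    grind
  | disj φ ψ ihφ ihψ =>
    simp only [Form.res, Set.exists_mem_image2, Form.Sat, ihφ h.1, ihψ h.2]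
    grind
  | idisj φ ψ ihφ ihψ =>
    simp only [Form.res, Set.mem_union, Form.Sat, ihφ h.1, ihψ h.2, or_and_right, exists_or]

/-- A team satisfies a multiset of formulas iff it satisfies one of its resolutions. -/
theorem satAll_iff_exists_mres {Γ : Multiset Form} (h : ∀ φ ∈ Γ, φ.WF) (t : Team) :
    SatAll t Γ ↔ ∃ Ξ ∈ mres Γ, SatAll t Ξ := by
  constructor
  · intro hΓ
    choose! f hf hsat using fun φ hφ => ((h φ hφ).sat_iff_exists_res t).1 (hΓ φ hφ)
    exact ⟨Γ.map f, ⟨f, hf, rfl⟩, by simpa [SatAll] using hsat⟩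
  · rintro ⟨_, ⟨f, hf, rfl⟩, hsat⟩ φ hφ
    exact ((h φ hφ).sat_iff_exists_res t).2
      ⟨f φ, hf φ hφ, hsat _ (Multiset.mem_map_of_mem f hφ)⟩

/-- Normal form: a team satisfies a PL(∨∨) formula iff it
satisfies one of its resolutions; and likewise for finite multisets. -/
theorem normal_form :
    (∀ φ : Form, φ.WF → ∀ t : Team,
        Form.Sat φ t ↔ ∃ α ∈ Form.res φ, Form.Sat α t) ∧
    (∀ Γ : Multiset Form, (∀ φ ∈ Γ, Form.WF φ) → ∀ t : Team,
        SatAll t Γ ↔ ∃ Ξ ∈ mres Γ, SatAll t Ξ) := by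
  exact ⟨fun _ h t => h.sat_iff_exists_res t, fun _ h t => satAll_iff_exists_mres h t⟩
end

section
/- Split property: for any multiset Λ of classical formulas and any PL(∨∨) formulas φ, ψ: Λ ⊨ φ∨∨ψ if and only if Λ ⊨ φ or Λ ⊨ ψ. -/
namespace Form

/-- Team satisfaction is downward closed. -/
theorem Sat.mono {φ : Form} {s t : Team} (h : φ.Sat t) (hst : s ⊆ t) : φ.Sat s := by
  induction φ generalizing s t with
  | var p => exact fun v hv => h v (hst hv)
  | bot => exact Set.subset_eq_empty hst h
  | neg α _ => exact fun v hv => h v (hst hv)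
  | conj φ ψ ihφ ihψ => exact ⟨ihφ h.1 hst, ihψ h.2 hst⟩
  | disj φ ψ ihφ ihψ =>
    obtain ⟨a, b, rfl, ha, hb⟩ := h
    exact ⟨s ∩ a, s ∩ b, by rw [← Set.inter_union_distrib_left, Set.inter_eq_left.mpr hst],
      ihφ ha Set.inter_subset_right, ihψ hb Set.inter_subset_right⟩
  | idisj φ ψ ihφ ihψ => exact h.imp (ihφ · hst) (ihψ · hst)

/-- Classical formulas are flat: a team satisfies one iff each of its valuations does. -/
theorem IsClassical.sat_iff {α : Form} (hα : α.IsClassical) {t : Team} :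
    α.Sat t ↔ ∀ v ∈ t, α.CSat v := by
  induction α generalizing t with
  | var p => exact Iff.rfl
  | bot => exact Set.eq_empty_iff_forall_notMem
  | neg α ih => simp [Sat, CSat, ih hα]
  | conj α β ihα ihβ =>
    simp only [Sat, CSat, ihα hα.1, ihβ hα.2]
    exact ⟨fun h v hv => ⟨h.1 v hv, h.2 v hv⟩, fun h => ⟨fun v hv => (h v hv).1,
      fun v hv => (h v hv).2⟩⟩
  | disj α β ihα ihβ =>
    simp only [Sat, CSat, ihα hα.1, ihβ hα.2]
    constructor
    · rintro ⟨s, u, rfl, hs, hu⟩ v hv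
      exact hv.imp (hs v) (hu v)
    · intro h
      refine ⟨{v ∈ t | α.CSat v}, {v ∈ t | β.CSat v}, ?_, fun v hv => hv.2, fun v hv => hv.2⟩
      ext v
      exact ⟨fun hv => (h v hv).imp (⟨hv, ·⟩) (⟨hv, ·⟩), fun hv => hv.elim (·.1) (·.1)⟩
  | idisj φ ψ _ _ => exact hα.elim

end Form

/-- Entailment from classical premises reduces to the team of all classical models. -/
theorem entails_iff_sat_models {Λ : Multiset Form} (hΛ : ∀ α ∈ Λ, Form.IsClassical α)
    (φ : Form) : Entails Λ φ ↔ φ.Sat {v | ∀ α ∈ Λ, α.CSat v} :=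
  ⟨fun h => h _ fun α hα => (hΛ α hα).sat_iff.mpr fun _ hv => hv α hα,
    fun h _ ht => h.mono fun v hv α hα => (hΛ α hα).sat_iff.mp (ht α hα) v hv⟩

/-- Split property: for a multiset Λ of classical formulas and
PL(∨∨) formulas φ, ψ: Λ ⊨ φ∨∨ψ iff Λ ⊨ φ or Λ ⊨ ψ. -/
theorem split_property (Λ : Multiset Form) (φ ψ : Form)
    (hΛ : ∀ α ∈ Λ, Form.IsClassical α) (hφ : φ.WF) (hψ : ψ.WF) :
    Entails Λ (Form.idisj φ ψ) ↔ (Entails Λ φ ∨ Entails Λ ψ) := by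
  simp only [entails_iff_sat_models hΛ, Form.Sat]
end

section
/- Soundness of GT: if the sequent Γ ⇒ Δ is derivable in the calculus GT, then Γ ⊨ ⋁Δ (where ⋁ of the empty multiset is ⊥). -/
namespace Form

theorem sat_empty (φ : Form) : φ.Sat ∅ := by
  induction φ with
  | var p => exact fun v hv => hv.elim
  | bot => rfl
  | neg α _ => exact fun v hv => hv.elim
  | conj φ ψ ih₁ ih₂ => exact ⟨ih₁, ih₂⟩
  | disj φ ψ ih₁ ih₂ => exact ⟨∅, ∅, by simp, ih₁, ih₂⟩
  | idisj φ ψ ih₁ _ => exact Or.inl ih₁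

/-- Classical formulas are flat. -/
theorem IsClassical.sat_of_forall_singleton {α : Form} (hα : α.IsClassical) {t : Team}
    (h : ∀ v ∈ t, α.Sat {v}) : α.Sat t := by
  induction α generalizing t with
  | var p => exact fun v hv => h v hv v rfl
  | bot =>
    exact Set.eq_empty_of_forall_notMem fun v hv => Set.singleton_ne_empty v (h v hv)
  | neg α _ => exact fun v hv => h v hv v rfl
  | conj α β ih₁ ih₂ => exact ⟨ih₁ hα.1 fun v hv => (h v hv).1, ih₂ hα.2 fun v hv => (h v hv).2⟩
  | disj α β ih₁ ih₂ =>
    refine ⟨{v ∈ t | α.Sat {v}}, {v ∈ t | β.Sat {v}}, ?_, ih₁ hα.1 fun v hv => hv.2,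
      ih₂ hα.2 fun v hv => hv.2⟩
    ext v
    refine ⟨fun hv => ?_, fun hv => hv.elim And.left And.left⟩
    obtain ⟨a, b, hab, ha, hb⟩ := h v hv
    have hvab : v ∈ a ∪ b := hab ▸ Set.mem_singleton v
    exact hvab.imp (fun hva => ⟨hv, ha.mono (Set.singleton_subset_iff.2 hva)⟩)
      (fun hvb => ⟨hv, hb.mono (Set.singleton_subset_iff.2 hvb)⟩)
  | idisj α β _ _ => exact hα.elim

theorem IsClassical.sat_union {α : Form} (hα : α.IsClassical) {s t : Team}
    (hs : α.Sat s) (ht : α.Sat t) : α.Sat (s ∪ t) :=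
  hα.sat_of_forall_singleton fun _ hv =>
    hv.elim (fun h => hs.mono (Set.singleton_subset_iff.2 h))
      (fun h => ht.mono (Set.singleton_subset_iff.2 h))

theorem sat_disj_assoc {φ ψ χ : Form} {t : Team} :
    (disj (disj φ ψ) χ).Sat t ↔ (disj φ (disj ψ χ)).Sat t := by
  constructor
  · rintro ⟨_, c, rfl, ⟨a, b, rfl, ha, hb⟩, hc⟩
    exact ⟨a, b ∪ c, Set.union_assoc a b c, ha, b, c, rfl, hb, hc⟩
  · rintro ⟨a, _, rfl, ha, b, c, rfl, hb, hc⟩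
    exact ⟨a ∪ b, c, (Set.union_assoc a b c).symm, ⟨a, b, rfl, ha, hb⟩, hc⟩

theorem sat_disj_comm {φ ψ : Form} {t : Team} : (disj φ ψ).Sat t ↔ (disj ψ φ).Sat t := by
  constructor <;> exact fun ⟨a, b, h, ha, hb⟩ => ⟨b, a, h.trans (Set.union_comm a b), hb, ha⟩

theorem sat_disj_congr {φ φ' ψ ψ' : Form} (hφ : ∀ t, φ.Sat t ↔ φ'.Sat t)
    (hψ : ∀ t, ψ.Sat t ↔ ψ'.Sat t) (t : Team) : (disj φ ψ).Sat t ↔ (disj φ' ψ').Sat t := by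
  simp only [Sat, hφ, hψ]

theorem sat_foldr_disj_perm {l₁ l₂ : List Form} (h : l₁.Perm l₂) (t : Team) :
    (l₁.foldr disj bot).Sat t ↔ (l₂.foldr disj bot).Sat t := by
  induction h generalizing t with
  | nil => rfl
  | cons φ _ ih => exact sat_disj_congr (fun _ => Iff.rfl) ih t
  | swap φ ψ l =>
    simp only [List.foldr_cons]
    rw [← sat_disj_assoc, ← sat_disj_assoc]
    exact sat_disj_congr (fun _ => sat_disj_comm) (fun _ => Iff.rfl) t
  | trans _ _ ih₁ ih₂ => exact (ih₁ t).trans (ih₂ t)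

end Form

open Form

theorem sat_bigVee_cons {φ : Form} {Δ : Multiset Form} {t : Team} :
    (bigVee (φ ::ₘ Δ)).Sat t ↔ ∃ s u, t = s ∪ u ∧ φ.Sat s ∧ (bigVee Δ).Sat u := by
  have h : (φ ::ₘ Δ).toList.Perm (φ :: Δ.toList) := by
    rw [← Multiset.coe_eq_coe, ← Multiset.cons_coe, Multiset.coe_toList, Multiset.coe_toList]
  exact sat_foldr_disj_perm h t

theorem sat_bigVee_add {Δ S : Multiset Form} {t : Team} :
    (bigVee (Δ + S)).Sat t ↔ ∃ s u, t = s ∪ u ∧ (bigVee Δ).Sat s ∧ (bigVee S).Sat u := by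
  induction Δ using Multiset.induction generalizing t with
  | empty =>
    simp [bigVee, Sat]
  | cons φ Δ ih =>
    rw [Multiset.cons_add, sat_bigVee_cons]
    simp only [ih, sat_bigVee_cons]
    exact sat_disj_assoc (φ := φ) (ψ := bigVee Δ) (χ := bigVee S) |>.symm

theorem sat_bigVee_add_left {Δ S : Multiset Form} {t : Team} (h : (bigVee Δ).Sat t) :
    (bigVee (Δ + S)).Sat t :=
  sat_bigVee_add.2 ⟨t, ∅, by simp, h, sat_empty _⟩

theorem isClassical_bigVee {Λ : Multiset Form} (h : ∀ γ ∈ Λ, γ.IsClassical) :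
    (bigVee Λ).IsClassical := by
  have key : ∀ l : List Form, (∀ γ ∈ l, γ.IsClassical) → (l.foldr disj bot).IsClassical := by
    intro l hl
    induction l with
    | nil => trivial
    | cons γ l ih =>
      exact ⟨hl γ List.mem_cons_self, ih fun δ hδ => hl δ (List.mem_cons_of_mem γ hδ)⟩
  exact key _ fun γ hγ => h γ (Multiset.mem_toList.1 hγ)

theorem sat_bigVee_cons_mono {φ ψ : Form} {Δ : Multiset Form} {t : Team}
    (hφψ : ∀ s, φ.Sat s → ψ.Sat s) (h : (bigVee (φ ::ₘ Δ)).Sat t) :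
    (bigVee (ψ ::ₘ Δ)).Sat t := by
  obtain ⟨s, u, rfl, hs, hu⟩ := sat_bigVee_cons.1 h
  exact sat_bigVee_cons.2 ⟨s, u, rfl, hφψ s hs, hu⟩

theorem satAll_cons {φ : Form} {Γ : Multiset Form} {t : Team} :
    SatAll t (φ ::ₘ Γ) ↔ φ.Sat t ∧ SatAll t Γ := by
  simp [SatAll]

theorem SatAll.mono {Γ : Multiset Form} {s t : Team} (h : SatAll t Γ) (hst : s ⊆ t) :
    SatAll s Γ :=
  fun φ hφ => (h φ hφ).mono hst

/-- Inquisitive disjunction distributes over every context whose hole is not under a negation. -/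
theorem Ctx.sat_fill_idisj (χ : Ctx) (φ ψ : Form) (t : Team) :
    (χ.fill (idisj φ ψ)).Sat t ↔ (χ.fill φ).Sat t ∨ (χ.fill ψ).Sat t := by
  induction χ generalizing t with
  | hole => rfl
  | conjL c θ ih => simp only [Ctx.fill, Sat, ih, or_and_right]
  | conjR θ c ih => simp only [Ctx.fill, Sat, ih, and_or_left]
  | disjL c θ ih => simp only [Ctx.fill, Sat, ih, or_and_right, and_or_left, exists_or]
  | disjR θ c ih => simp only [Ctx.fill, Sat, ih, and_or_left, exists_or]
  | idisjL c θ ih => simp only [Ctx.fill, Sat, ih]; tauto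
  | idisjR θ c ih => simp only [Ctx.fill, Sat, ih]; tauto

theorem GT.entails {c : Bool} {n : ℕ} {Γ Δ : Multiset Form} (h : GT c n Γ Δ) :
    Entails Γ (bigVee Δ) := by
  induction h with
  | ax c n Γ Δ p =>
    intro t ht
    exact sat_bigVee_cons.2 ⟨t, ∅, by simp, (satAll_cons.1 ht).1, sat_empty _⟩
  | lbot c n Γ Δ =>
    intro t ht
    obtain rfl : t = ∅ := (satAll_cons.1 ht).1
    exact sat_empty _
  | lneg c n Γ Δ α hα _ ih =>
    intro t ht
    obtain ⟨hneg, hΓ⟩ := satAll_cons.1 ht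
    obtain ⟨s, u, rfl, hs, hu⟩ := sat_bigVee_cons.1 (ih t hΓ)
    obtain rfl : s = ∅ := Set.eq_empty_of_forall_notMem fun v hv =>
      hneg v (Or.inl hv) (hs.mono (Set.singleton_subset_iff.2 hv))
    rwa [Set.empty_union]
  | rneg c n Γ Δ α hα _ ih =>
    intro t ht
    refine sat_bigVee_cons.2 ⟨{v ∈ t | ¬ α.Sat {v}}, {v ∈ t | α.Sat {v}}, ?_,
      fun v hv => hv.2, ih _ (satAll_cons.2
        ⟨hα.sat_of_forall_singleton fun v hv => hv.2, ht.mono (Set.sep_subset t _)⟩)⟩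
    ext v
    simp only [Set.mem_union, Set.mem_ofPred_eq]
    tauto
  | lconj c n Γ Δ φ ψ _ ih =>
    intro t ht
    obtain ⟨⟨hφ, hψ⟩, hΓ⟩ := satAll_cons.1 ht
    exact ih t (satAll_cons.2 ⟨hφ, satAll_cons.2 ⟨hψ, hΓ⟩⟩)
  | rconj c n Γ Λ Δ φ ψ hΛ _ _ ih₁ ih₂ =>
    intro t ht
    obtain ⟨s₁, u₁, h₁, hs₁, hu₁⟩ := sat_bigVee_cons.1 (ih₁ t ht)
    obtain ⟨s₂, u₂, h₂, hs₂, hu₂⟩ := sat_bigVee_cons.1 (ih₂ t ht)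
    refine sat_bigVee_cons.2 ⟨s₁ ∩ s₂, u₁ ∪ u₂, ?_,
      ⟨hs₁.mono Set.inter_subset_left, hs₂.mono Set.inter_subset_right⟩,
      sat_bigVee_add_left ((isClassical_bigVee hΛ).sat_union hu₁ hu₂)⟩
    ext v
    have e₁ : v ∈ t ↔ v ∈ s₁ ∨ v ∈ u₁ := by rw [h₁]; rfl
    have e₂ : v ∈ t ↔ v ∈ s₂ ∨ v ∈ u₂ := by rw [h₂]; rfl
    simp only [Set.mem_union, Set.mem_inter_iff]
    tauto
  | ldisj c n Γ Λ Δ φ ψ hΛ _ _ ih₁ ih₂ =>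
    intro t ht
    obtain ⟨⟨s, u, rfl, hs, hu⟩, hΓ⟩ := satAll_cons.1 ht
    exact sat_bigVee_add_left ((isClassical_bigVee hΛ).sat_union
      (ih₁ s (satAll_cons.2 ⟨hs, hΓ.mono Set.subset_union_left⟩))
      (ih₂ u (satAll_cons.2 ⟨hu, hΓ.mono Set.subset_union_right⟩)))
  | rdisj c n Γ Δ φ ψ _ ih =>
    intro t ht
    obtain ⟨s, _, rfl, hs, h⟩ := sat_bigVee_cons.1 (ih t ht)
    obtain ⟨u, w, rfl, hu, hw⟩ := sat_bigVee_cons.1 h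
    exact sat_bigVee_cons.2
      ⟨s ∪ u, w, (Set.union_assoc s u w).symm, ⟨s, u, rfl, hs, hu⟩, hw⟩
  | lidisj c n Γ Δ χ φL φR _ _ ih₁ ih₂ =>
    intro t ht
    obtain ⟨hχ, hΓ⟩ := satAll_cons.1 ht
    exact ((χ.sat_fill_idisj φL φR t).1 hχ).elim
      (fun h => ih₁ t (satAll_cons.2 ⟨h, hΓ⟩)) (fun h => ih₂ t (satAll_cons.2 ⟨h, hΓ⟩))
  | ridisjL c n Γ Δ χ φL φR _ ih =>
    exact fun t ht => sat_bigVee_cons_mono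
      (fun s hs => (χ.sat_fill_idisj φL φR s).2 (Or.inl hs)) (ih t ht)
  | ridisjR c n Γ Δ χ φL φR _ ih =>
    exact fun t ht => sat_bigVee_cons_mono
      (fun s hs => (χ.sat_fill_idisj φL φR s).2 (Or.inr hs)) (ih t ht)
  | cut n Γ Δ Θ S φ _ _ ih₁ ih₂ =>
    intro t ht
    have hΓ : SatAll t Γ := fun θ hθ => ht θ (Multiset.mem_add.2 (Or.inl hθ))
    have hΘ : SatAll t Θ := fun θ hθ => ht θ (Multiset.mem_add.2 (Or.inr hθ))
    obtain ⟨s, u, rfl, hs, hu⟩ := sat_bigVee_cons.1 (ih₁ t hΓ)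
    exact sat_bigVee_add.2 ⟨u, s, Set.union_comm s u, hu,
      ih₂ s (satAll_cons.2 ⟨hs, hΘ.mono Set.subset_union_left⟩)⟩

/-- Soundness of GT: if Γ ⇒ Δ is derivable in GT, then
Γ ⊨ ⋁Δ. -/
theorem GT_soundness (Γ Δ : Multiset Form)
    (hΓ : ∀ φ ∈ Γ, Form.WF φ) (hΔ : ∀ φ ∈ Δ, Form.WF φ)
    (h : ∃ n, GT true n Γ Δ) : Entails Γ (bigVee Δ) := by
  exact h.elim fun _ hn => hn.entails
end

section
/- Height-preserving inversion for GT⁻: writing ⊢ⁿ for derivability in GT⁻ with height at most n: (L¬) ⊢ⁿ Γ,¬α⇒Δ implies ⊢ⁿ Γ⇒α,Δ; (R¬) ⊢ⁿ Γ⇒¬α,Δ implies ⊢ⁿ Γ,α⇒Δ; (L∧) ⊢ⁿ Γ,φ∧ψ⇒Δ implies ⊢ⁿ Γ,φ,ψ⇒Δ; (R∧) ⊢ⁿ Γ⇒φ∧ψ,Δ implies ⊢ⁿ Γ⇒φ,Δ and ⊢ⁿ Γ⇒ψ,Δ; (L∨) ⊢ⁿ Γ,φ∨ψ⇒Δ implies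 ⊢ⁿ Γ,φ⇒Δ and ⊢ⁿ Γ,ψ⇒Δ; (R∨) ⊢ⁿ Γ⇒φ∨ψ,Δ implies ⊢ⁿ Γ⇒φ,ψ,Δ; (L∨∨) ⊢ⁿ Γ,χ{φ_L∨∨φ_R}⇒Δ implies ⊢ⁿ Γ,χ{φ_L}⇒Δ and ⊢ⁿ Γ,χ{φ_R}⇒Δ. -/
namespace Form

/-- `Splits X Y Z` says that `Y` and `Z` arise from `X` by replacing one occurrence of an
inquisitive disjunction outside the scope of negation by its left and right disjunct. -/
inductive Splits : Form → Form → Form → Prop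
  | base (a b : Form) : Splits (idisj a b) a b
  | conjL {X Y Z : Form} (w : Form) : Splits X Y Z → Splits (conj X w) (conj Y w) (conj Z w)
  | conjR {X Y Z : Form} (w : Form) : Splits X Y Z → Splits (conj w X) (conj w Y) (conj w Z)
  | disjL {X Y Z : Form} (w : Form) : Splits X Y Z → Splits (disj X w) (disj Y w) (disj Z w)
  | disjR {X Y Z : Form} (w : Form) : Splits X Y Z → Splits (disj w X) (disj w Y) (disj w Z)
  | idisjL {X Y Z : Form} (w : Form) : Splits X Y Z → Splits (idisj X w) (idisj Y w) (idisj Z w)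
  | idisjR {X Y Z : Form} (w : Form) : Splits X Y Z → Splits (idisj w X) (idisj w Y) (idisj w Z)

theorem splits_fill (a b : Form) : ∀ χ : Ctx, Splits (χ.fill (idisj a b)) (χ.fill a) (χ.fill b)
  | .hole => .base a b
  | .conjL c w => .conjL w (splits_fill a b c)
  | .conjR w c => .conjR w (splits_fill a b c)
  | .disjL c w => .disjL w (splits_fill a b c)
  | .disjR w c => .disjR w (splits_fill a b c)
  | .idisjL c w => .idisjL w (splits_fill a b c)
  | .idisjR w c => .idisjR w (splits_fill a b c)

theorem Splits.exists_fill {X Y Z : Form} (h : Splits X Y Z) :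
    ∃ (χ : Ctx) (a b : Form), X = χ.fill (idisj a b) ∧ Y = χ.fill a ∧ Z = χ.fill b := by
  induction h with
  | base a b => exact ⟨.hole, a, b, rfl, rfl, rfl⟩
  | conjL w _ ih => obtain ⟨χ, a, b, rfl, rfl, rfl⟩ := ih; exact ⟨.conjL χ w, a, b, rfl, rfl, rfl⟩
  | conjR w _ ih => obtain ⟨χ, a, b, rfl, rfl, rfl⟩ := ih; exact ⟨.conjR w χ, a, b, rfl, rfl, rfl⟩
  | disjL w _ ih => obtain ⟨χ, a, b, rfl, rfl, rfl⟩ := ih; exact ⟨.disjL χ w, a, b, rfl, rfl, rfl⟩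
  | disjR w _ ih => obtain ⟨χ, a, b, rfl, rfl, rfl⟩ := ih; exact ⟨.disjR w χ, a, b, rfl, rfl, rfl⟩
  | idisjL w _ ih => obtain ⟨χ, a, b, rfl, rfl, rfl⟩ := ih; exact ⟨.idisjL χ w, a, b, rfl, rfl, rfl⟩
  | idisjR w _ ih => obtain ⟨χ, a, b, rfl, rfl, rfl⟩ := ih; exact ⟨.idisjR w χ, a, b, rfl, rfl, rfl⟩

/-- `Chooses X Y` says that `Y` is one of the two results of some splitting of `X`. -/
def Chooses (X Y : Form) : Prop := ∃ Z, Splits X Y Z ∨ Splits X Z Y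

theorem Splits.left {X Y Z : Form} (h : Splits X Y Z) : Chooses X Y := ⟨Z, .inl h⟩

theorem Splits.right {X Y Z : Form} (h : Splits X Y Z) : Chooses X Z := ⟨Y, .inr h⟩

theorem Chooses.map {f : Form → Form}
    (hf : ∀ {X Y Z : Form}, Splits X Y Z → Splits (f X) (f Y) (f Z)) {X Y : Form}
    (h : Chooses X Y) : Chooses (f X) (f Y) := by
  obtain ⟨Z, h | h⟩ := h
  · exact (hf h).left
  · exact (hf h).right

theorem Chooses.conj_inv {φ ψ T : Form} (h : Chooses (conj φ ψ) T) :
    (∃ φ', Chooses φ φ' ∧ T = conj φ' ψ) ∨ ∃ ψ', Chooses ψ ψ' ∧ T = conj φ ψ' := by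
  obtain ⟨Z, h | h⟩ := h <;> cases h with
  | conjL _ h => exact .inl ⟨_, by first | exact h.left | exact h.right, rfl⟩
  | conjR _ h => exact .inr ⟨_, by first | exact h.left | exact h.right, rfl⟩

theorem Chooses.disj_inv {φ ψ T : Form} (h : Chooses (disj φ ψ) T) :
    (∃ φ', Chooses φ φ' ∧ T = disj φ' ψ) ∨ ∃ ψ', Chooses ψ ψ' ∧ T = disj φ ψ' := by
  obtain ⟨Z, h | h⟩ := h <;> cases h with
  | disjL _ h => exact .inl ⟨_, by first | exact h.left | exact h.right, rfl⟩
  | disjR _ h => exact .inr ⟨_, by first | exact h.left | exact h.right, rfl⟩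

theorem not_splits_neg {α Y Z : Form} : ¬ Splits (neg α) Y Z := nofun

theorem not_chooses_neg {α Y : Form} : ¬ Chooses (neg α) Y := by
  rintro ⟨Z, h | h⟩ <;> exact not_splits_neg h

/-- `T` is reached by a choice in `Y` or `Z`, or splits into formulas reached from `Y` and `Z`. -/
def Joins (T Y Z : Form) : Prop :=
  Relation.ReflGen Chooses Y T ∨ Relation.ReflGen Chooses Z T ∨
    ∃ T₁ T₂, Splits T T₁ T₂ ∧ Relation.ReflGen Chooses Y T₁ ∧ Relation.ReflGen Chooses Z T₂

theorem Joins.map {f : Form → Form}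
    (hf : ∀ {X Y Z : Form}, Splits X Y Z → Splits (f X) (f Y) (f Z)) {T Y Z : Form}
    (h : Joins T Y Z) : Joins (f T) (f Y) (f Z) := by
  have hr {A B : Form} (h : Relation.ReflGen Chooses A B) :
      Relation.ReflGen Chooses (f A) (f B) := by
    cases h with
    | refl => exact .refl
    | single h => exact .single (h.map hf)
  rcases h with h | h | ⟨T₁, T₂, h, h₁, h₂⟩
  · exact .inl (hr h)
  · exact .inr (.inl (hr h))
  · exact .inr (.inr ⟨_, _, hf h, hr h₁, hr h₂⟩)

theorem Splits.joins {X Y Z : Form} (h : Splits X Y Z) :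
    ∀ {Y' Z' : Form}, Splits X Y' Z' → Joins Y Y' Z' ∧ Joins Z Y' Z' := by
  induction h with
  | base a b =>
    intro Y' Z' h'
    cases h' with
    | base => exact ⟨.inl .refl, .inr (.inl .refl)⟩
    | idisjL _ h' =>
      exact ⟨.inr (.inr ⟨_, _, h', .single (Splits.base _ _).left, .single (Splits.base _ _).left⟩),
        .inl (.single (Splits.base _ _).right)⟩
    | idisjR _ h' =>
      exact ⟨.inl (.single (Splits.base _ _).left), .inr (.inr
        ⟨_, _, h', .single (Splits.base _ _).right, .single (Splits.base _ _).right⟩)⟩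
  | conjL w h ih =>
    intro Y' Z' h'
    cases h' with
    | conjL _ h' => exact ⟨(ih h').1.map (.conjL w), (ih h').2.map (.conjL w)⟩
    | conjR _ h' =>
      exact ⟨.inr (.inr ⟨_, _, .conjR _ h', .single (h.conjL _).left, .single (h.conjL _).left⟩),
        .inr (.inr ⟨_, _, .conjR _ h', .single (h.conjL _).right, .single (h.conjL _).right⟩)⟩
  | conjR w h ih =>
    intro Y' Z' h'
    cases h' with
    | conjR _ h' => exact ⟨(ih h').1.map (.conjR w), (ih h').2.map (.conjR w)⟩
    | conjL _ h' =>
      exact ⟨.inr (.inr ⟨_, _, .conjL _ h', .single (h.conjR _).left, .single (h.conjR _).left⟩),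
        .inr (.inr ⟨_, _, .conjL _ h', .single (h.conjR _).right, .single (h.conjR _).right⟩)⟩
  | disjL w h ih =>
    intro Y' Z' h'
    cases h' with
    | disjL _ h' => exact ⟨(ih h').1.map (.disjL w), (ih h').2.map (.disjL w)⟩
    | disjR _ h' =>
      exact ⟨.inr (.inr ⟨_, _, .disjR _ h', .single (h.disjL _).left, .single (h.disjL _).left⟩),
        .inr (.inr ⟨_, _, .disjR _ h', .single (h.disjL _).right, .single (h.disjL _).right⟩)⟩
  | disjR w h ih =>
    intro Y' Z' h'
    cases h' with
    | disjR _ h' => exact ⟨(ih h').1.map (.disjR w), (ih h').2.map (.disjR w)⟩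
    | disjL _ h' =>
      exact ⟨.inr (.inr ⟨_, _, .disjL _ h', .single (h.disjR _).left, .single (h.disjR _).left⟩),
        .inr (.inr ⟨_, _, .disjL _ h', .single (h.disjR _).right, .single (h.disjR _).right⟩)⟩
  | idisjL w h ih =>
    intro Y' Z' h'
    cases h' with
    | base =>
      exact ⟨.inr (.inr ⟨_, _, .base _ _, .single h.left, .refl⟩),
        .inr (.inr ⟨_, _, .base _ _, .single h.right, .refl⟩)⟩
    | idisjL _ h' => exact ⟨(ih h').1.map (.idisjL w), (ih h').2.map (.idisjL w)⟩
    | idisjR _ h' =>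
      exact ⟨.inr (.inr ⟨_, _, .idisjR _ h', .single (h.idisjL _).left, .single (h.idisjL _).left⟩),
        .inr (.inr ⟨_, _, .idisjR _ h', .single (h.idisjL _).right,
          .single (h.idisjL _).right⟩)⟩
  | idisjR w h ih =>
    intro Y' Z' h'
    cases h' with
    | base =>
      exact ⟨.inr (.inr ⟨_, _, .base _ _, .refl, .single h.left⟩),
        .inr (.inr ⟨_, _, .base _ _, .refl, .single h.right⟩)⟩
    | idisjR _ h' => exact ⟨(ih h').1.map (.idisjR w), (ih h').2.map (.idisjR w)⟩
    | idisjL _ h' =>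
      exact ⟨.inr (.inr ⟨_, _, .idisjL _ h', .single (h.idisjR _).left, .single (h.idisjR _).left⟩),
        .inr (.inr ⟨_, _, .idisjL _ h', .single (h.idisjR _).right,
          .single (h.idisjR _).right⟩)⟩

end Form

namespace GT

open Form

theorem left_of_splits {c : Bool} {n : ℕ} {Γ Δ : Multiset Form} {X Y Z : Form} (h : Splits X Y Z)
    (h₁ : GT c n (Y ::ₘ Γ) Δ) (h₂ : GT c n (Z ::ₘ Γ) Δ) : GT c (n + 1) (X ::ₘ Γ) Δ := by
  obtain ⟨χ, a, b, rfl, rfl, rfl⟩ := h.exists_fill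
  exact lidisj _ _ _ _ _ _ _ h₁ h₂

theorem right_of_chooses {c : Bool} {n : ℕ} {Γ Δ : Multiset Form} {X Y : Form}
    (h : Chooses X Y) (h₁ : GT c n Γ (Y ::ₘ Δ)) : GT c (n + 1) Γ (X ::ₘ Δ) := by
  obtain ⟨Z, h | h⟩ := h <;> obtain ⟨χ, a, b, rfl, rfl, rfl⟩ := h.exists_fill
  · exact ridisjL _ _ _ _ _ _ _ h₁
  · exact ridisjR _ _ _ _ _ _ _ h₁

theorem height_succ {c : Bool} {n : ℕ} {Γ Δ : Multiset Form} (h : GT c n Γ Δ) :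
    GT c (n + 1) Γ Δ := by
  induction h with
  | ax => exact ax ..
  | lbot => exact lbot ..
  | lneg _ _ _ _ _ hα _ ih => exact lneg _ _ _ _ _ hα ih
  | rneg _ _ _ _ _ hα _ ih => exact rneg _ _ _ _ _ hα ih
  | lconj _ _ _ _ _ _ _ ih => exact lconj _ _ _ _ _ _ ih
  | rconj _ _ _ _ _ _ _ hΛ _ _ ih₁ ih₂ => exact rconj _ _ _ _ _ _ _ hΛ ih₁ ih₂
  | ldisj _ _ _ _ _ _ _ hΛ _ _ ih₁ ih₂ => exact ldisj _ _ _ _ _ _ _ hΛ ih₁ ih₂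
  | rdisj _ _ _ _ _ _ _ ih => exact rdisj _ _ _ _ _ _ ih
  | lidisj _ _ _ _ _ _ _ _ _ ih₁ ih₂ => exact lidisj _ _ _ _ _ _ _ ih₁ ih₂
  | ridisjL _ _ _ _ _ _ _ _ ih => exact ridisjL _ _ _ _ _ _ _ ih
  | ridisjR _ _ _ _ _ _ _ _ ih => exact ridisjR _ _ _ _ _ _ _ ih
  | cut _ _ _ _ _ _ _ _ ih₁ ih₂ => exact cut _ _ _ _ _ _ ih₁ ih₂

/-- Height-preserving weakening. -/
theorem weaken {c : Bool} {n : ℕ} {Γ Δ : Multiset Form} (h : GT c n Γ Δ) (A B : Multiset Form) :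
    GT c n (Γ + A) (Δ + B) := by
  induction h generalizing A B with
  | ax _ _ Γ Δ p => simpa only [Multiset.cons_add] using ax _ _ (Γ + A) (Δ + B) p
  | lbot _ _ Γ Δ => simpa only [Multiset.cons_add] using lbot _ _ (Γ + A) (Δ + B)
  | lneg _ _ Γ Δ α hα _ ih =>
    simp only [Multiset.cons_add] at ih ⊢
    exact lneg _ _ _ _ _ hα (ih A B)
  | rneg _ _ Γ Δ α hα _ ih =>
    simp only [Multiset.cons_add] at ih ⊢
    exact rneg _ _ _ _ _ hα (ih A B)
  | lconj _ _ _ _ _ _ _ ih =>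
    simp only [Multiset.cons_add] at ih ⊢
    exact lconj _ _ _ _ _ _ (ih A B)
  | rconj _ _ _ _ _ _ _ hΛ _ _ ih₁ ih₂ =>
    simp only [Multiset.cons_add, add_assoc] at ih₁ ih₂ ⊢
    refine rconj _ _ _ _ _ _ _ hΛ ?_ ?_
    · simpa using ih₁ A 0
    · simpa using ih₂ A 0
  | ldisj _ _ _ _ _ _ _ hΛ _ _ ih₁ ih₂ =>
    simp only [Multiset.cons_add, add_assoc] at ih₁ ih₂ ⊢
    refine ldisj _ _ _ _ _ _ _ hΛ ?_ ?_
    · simpa using ih₁ A 0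
    · simpa using ih₂ A 0
  | rdisj _ _ _ _ _ _ _ ih =>
    simp only [Multiset.cons_add] at ih ⊢
    exact rdisj _ _ _ _ _ _ (ih A B)
  | lidisj _ _ _ _ _ _ _ _ _ ih₁ ih₂ =>
    simp only [Multiset.cons_add] at ih₁ ih₂ ⊢
    exact lidisj _ _ _ _ _ _ _ (ih₁ A B) (ih₂ A B)
  | ridisjL _ _ _ _ _ _ _ _ ih =>
    simp only [Multiset.cons_add] at ih ⊢
    exact ridisjL _ _ _ _ _ _ _ (ih A B)
  | ridisjR _ _ _ _ _ _ _ _ ih =>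
    simp only [Multiset.cons_add] at ih ⊢
    exact ridisjR _ _ _ _ _ _ _ (ih A B)
  | cut _ _ _ _ _ _ _ _ ih₁ ih₂ =>
    simp only [Multiset.cons_add, add_assoc] at ih₁ ih₂ ⊢
    refine cut _ _ _ _ _ _ ?_ (ih₂ A B)
    simpa using ih₁ 0 0

theorem cons_eq_cons_cases {X Y : Form} {Γ Γ' : Multiset Form} (h : Y ::ₘ Γ' = X ::ₘ Γ) :
    (X = Y ∧ Γ = Γ') ∨ ∃ Θ, Γ = Y ::ₘ Θ ∧ Γ' = X ::ₘ Θ := by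
  rcases Multiset.cons_eq_cons.1 h with ⟨h, h'⟩ | ⟨-, Θ, h, h'⟩
  · exact .inl ⟨h.symm, h'.symm⟩
  · exact .inr ⟨Θ, h', h⟩

theorem add_eq_cons_cases {X : Form} {Λ Δ' Δ : Multiset Form} (h : Λ + Δ' = X ::ₘ Δ) :
    (∃ Λ', Λ = X ::ₘ Λ' ∧ Δ = Λ' + Δ') ∨ ∃ Θ, Δ' = X ::ₘ Θ ∧ Δ = Λ + Θ := by
  have hX : X ∈ Λ + Δ' := h ▸ Multiset.mem_cons_self X Δ
  rcases Multiset.mem_add.1 hX with hX | hX <;>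
    obtain ⟨Θ, rfl⟩ := Multiset.exists_cons_of_mem hX
  · rw [Multiset.cons_add, Multiset.cons_inj_right] at h
    exact .inl ⟨Θ, rfl, h.symm⟩
  · rw [Multiset.add_cons, Multiset.cons_inj_right] at h
    exact .inr ⟨Θ, rfl, h.symm⟩

/-- Inversion step on the left: if replacing `X` by `A` on the left and `B` on the right is
admissible at height `n`, it is admissible at height `n + 1` once the cases with `X` principal
are settled. -/
theorem left_step {n : ℕ} {X : Form} {A B Γ Δ : Multiset Form}
    (hB : ∀ γ ∈ B, γ.IsClassical)
    (ih : ∀ Γ Δ, GT false n (X ::ₘ Γ) Δ → GT false n (A + Γ) (B + Δ))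
    (hvar : ∀ p, X ≠ var p) (hbot : X ≠ bot)
    (hneg : ∀ α, X = neg α → GT false n Γ (α ::ₘ Δ) → GT false (n + 1) (A + Γ) (B + Δ))
    (hconj : ∀ φ ψ, X = conj φ ψ → GT false n (φ ::ₘ ψ ::ₘ Γ) Δ →
      GT false (n + 1) (A + Γ) (B + Δ))
    (hdisj : ∀ φ ψ Λ Θ, X = disj φ ψ → Δ = Λ + Θ → (∀ γ ∈ Λ, γ.IsClassical) →
      GT false n (φ ::ₘ Γ) Λ → GT false n (ψ ::ₘ Γ) Λ → GT false (n + 1) (A + Γ) (B + Δ))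
    (hsplit : ∀ Y Z, Splits X Y Z → GT false n (Y ::ₘ Γ) Δ → GT false n (Z ::ₘ Γ) Δ →
      GT false (n + 1) (A + Γ) (B + Δ))
    (h : GT false (n + 1) (X ::ₘ Γ) Δ) : GT false (n + 1) (A + Γ) (B + Δ) := by
  have hBΛ {Λ : Multiset Form} (hΛ : ∀ γ ∈ Λ, γ.IsClassical) : ∀ γ ∈ B + Λ, γ.IsClassical :=
    fun γ hγ => (Multiset.mem_add.1 hγ).elim (hB γ) (hΛ γ)
  generalize hΓ : X ::ₘ Γ = Γ' at h
  cases h with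
  | ax _ _ Γ₁ Δ₁ p =>
    rcases cons_eq_cons_cases hΓ.symm with ⟨rfl, rfl⟩ | ⟨Θ, rfl, rfl⟩
    · exact absurd rfl (hvar p)
    · simpa only [Multiset.add_cons] using ax _ _ (A + Θ) (B + Δ₁) p
  | lbot =>
    rcases cons_eq_cons_cases hΓ.symm with ⟨rfl, rfl⟩ | ⟨Θ, rfl, rfl⟩
    · exact absurd rfl hbot
    · simpa only [Multiset.add_cons] using lbot _ _ (A + Θ) (B + Δ)
  | lneg _ _ Γ₁ _ α hα h =>
    rcases cons_eq_cons_cases hΓ.symm with ⟨rfl, rfl⟩ | ⟨Θ, rfl, rfl⟩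
    · exact hneg α rfl h
    · have := ih _ _ h
      simp only [Multiset.add_cons] at this ⊢
      exact lneg _ _ _ _ _ hα this
  | rneg _ _ _ Δ₁ α hα h =>
    subst hΓ
    rw [Multiset.cons_swap] at h
    have := ih _ _ h
    simp only [Multiset.add_cons] at this ⊢
    exact rneg _ _ _ _ _ hα this
  | lconj _ _ Γ₁ _ φ ψ h =>
    rcases cons_eq_cons_cases hΓ.symm with ⟨rfl, rfl⟩ | ⟨Θ, rfl, rfl⟩
    · exact hconj φ ψ rfl h
    · rw [Multiset.cons_swap ψ, Multiset.cons_swap φ] at h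
      have := ih _ _ h
      simp only [Multiset.add_cons] at this ⊢
      exact lconj _ _ _ _ _ _ this
  | rconj _ _ _ Λ Δ₁ φ ψ hΛ h₁ h₂ =>
    subst hΓ
    have h₁ := ih _ _ h₁
    have h₂ := ih _ _ h₂
    simp only [Multiset.add_cons, ← add_assoc] at h₁ h₂ ⊢
    exact rconj _ _ _ _ _ _ _ (hBΛ hΛ) h₁ h₂
  | ldisj _ _ Γ₁ Λ Δ₁ φ ψ hΛ h₁ h₂ =>
    rcases cons_eq_cons_cases hΓ.symm with ⟨rfl, rfl⟩ | ⟨Θ, rfl, rfl⟩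
    · exact hdisj φ ψ Λ Δ₁ rfl rfl hΛ h₁ h₂
    · rw [Multiset.cons_swap] at h₁ h₂
      have h₁ := ih _ _ h₁
      have h₂ := ih _ _ h₂
      simp only [Multiset.add_cons, ← add_assoc] at h₁ h₂ ⊢
      exact ldisj _ _ _ _ _ _ _ (hBΛ hΛ) h₁ h₂
  | rdisj _ _ _ Δ₁ φ ψ h =>
    subst hΓ
    have := ih _ _ h
    simp only [Multiset.add_cons] at this ⊢
    exact rdisj _ _ _ _ _ _ this
  | lidisj _ _ Γ₁ _ χ a b h₁ h₂ =>
    rcases cons_eq_cons_cases hΓ.symm with ⟨rfl, rfl⟩ | ⟨Θ, rfl, rfl⟩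
    · exact hsplit _ _ (splits_fill a b χ) h₁ h₂
    · rw [Multiset.cons_swap] at h₁ h₂
      have h₁ := ih _ _ h₁
      have h₂ := ih _ _ h₂
      simp only [Multiset.add_cons] at h₁ h₂ ⊢
      exact lidisj _ _ _ _ _ _ _ h₁ h₂
  | ridisjL _ _ _ Δ₁ χ a b h =>
    subst hΓ
    have := ih _ _ h
    simp only [Multiset.add_cons] at this ⊢
    exact ridisjL _ _ _ _ _ _ _ this
  | ridisjR _ _ _ Δ₁ χ a b h =>
    subst hΓ
    have := ih _ _ h
    simp only [Multiset.add_cons] at this ⊢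
    exact ridisjR _ _ _ _ _ _ _ this

/-- Inversion step on the right: if replacing `X` by `A` on the left and `B` on the right is
admissible at height `n`, it is admissible at height `n + 1` once the cases with `X` principal
are settled. -/
theorem right_step {n : ℕ} {X : Form} {A B Γ Δ : Multiset Form}
    (hB : X.IsClassical → ∀ γ ∈ B, γ.IsClassical)
    (ih : ∀ Γ Δ, GT false n Γ (X ::ₘ Δ) → GT false n (A + Γ) (B + Δ))
    (hvar : ∀ p, X ≠ var p)
    (hneg : ∀ α, X = neg α → GT false n (α ::ₘ Γ) Δ → GT false (n + 1) (A + Γ) (B + Δ))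
    (hconj : ∀ φ ψ Λ Θ, X = conj φ ψ → Δ = Λ + Θ → GT false n Γ (φ ::ₘ Λ) →
      GT false n Γ (ψ ::ₘ Λ) → GT false (n + 1) (A + Γ) (B + Δ))
    (hdisj : ∀ φ ψ, X = disj φ ψ → GT false n Γ (φ ::ₘ ψ ::ₘ Δ) →
      GT false (n + 1) (A + Γ) (B + Δ))
    (hchoose : ∀ Y, Chooses X Y → GT false n Γ (Y ::ₘ Δ) → GT false (n + 1) (A + Γ) (B + Δ))
    (h : GT false (n + 1) Γ (X ::ₘ Δ)) : GT false (n + 1) (A + Γ) (B + Δ) := by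
  have hBΛ {Λ : Multiset Form} (hΛ : ∀ γ ∈ X ::ₘ Λ, γ.IsClassical) :
      ∀ γ ∈ B + Λ, γ.IsClassical := fun γ hγ =>
    (Multiset.mem_add.1 hγ).elim (hB (hΛ X (Multiset.mem_cons_self X Λ)) γ)
      fun hγ => hΛ γ (Multiset.mem_cons_of_mem hγ)
  generalize hΔ : X ::ₘ Δ = Δ' at h
  cases h with
  | ax _ _ Γ₁ Δ₁ p =>
    rcases cons_eq_cons_cases hΔ.symm with ⟨rfl, rfl⟩ | ⟨Θ, rfl, rfl⟩
    · exact absurd rfl (hvar p)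
    · simpa only [Multiset.add_cons] using ax _ _ (A + Γ₁) (B + Θ) p
  | lbot _ _ Γ₁ =>
    simpa only [Multiset.add_cons] using lbot _ _ (A + Γ₁) (B + Δ)
  | lneg _ _ Γ₁ _ α hα h =>
    subst hΔ
    rw [Multiset.cons_swap] at h
    have := ih _ _ h
    simp only [Multiset.add_cons] at this ⊢
    exact lneg _ _ _ _ _ hα this
  | rneg _ _ _ Δ₁ α hα h =>
    rcases cons_eq_cons_cases hΔ.symm with ⟨rfl, rfl⟩ | ⟨Θ, rfl, rfl⟩
    · exact hneg α rfl h
    · have := ih _ _ h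
      simp only [Multiset.add_cons] at this ⊢
      exact rneg _ _ _ _ _ hα this
  | lconj _ _ Γ₁ _ φ ψ h =>
    subst hΔ
    have := ih _ _ h
    simp only [Multiset.add_cons] at this ⊢
    exact lconj _ _ _ _ _ _ this
  | rconj _ _ _ Λ Δ₁ φ ψ hΛ h₁ h₂ =>
    rcases cons_eq_cons_cases hΔ.symm with ⟨rfl, rfl⟩ | ⟨Θ, rfl, hΘ⟩
    · exact hconj φ ψ Λ Δ₁ rfl rfl h₁ h₂
    · rcases add_eq_cons_cases hΘ with ⟨Λ', rfl, rfl⟩ | ⟨Θ', rfl, rfl⟩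
      · rw [Multiset.cons_swap] at h₁ h₂
        have h₁ := ih _ _ h₁
        have h₂ := ih _ _ h₂
        simp only [Multiset.add_cons, ← add_assoc] at h₁ h₂ ⊢
        exact rconj _ _ _ _ _ _ _ (hBΛ hΛ) h₁ h₂
      · have h₁ := h₁.weaken A 0
        have h₂ := h₂.weaken A 0
        rw [add_zero, add_comm] at h₁ h₂
        rw [Multiset.add_cons, add_left_comm]
        exact rconj _ _ _ _ _ _ _ hΛ h₁ h₂
  | ldisj _ _ Γ₁ Λ Δ₁ φ ψ hΛ h₁ h₂ =>
    rcases add_eq_cons_cases hΔ.symm with ⟨Λ', rfl, rfl⟩ | ⟨Θ', rfl, rfl⟩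
    · have h₁ := ih _ _ h₁
      have h₂ := ih _ _ h₂
      simp only [Multiset.add_cons, ← add_assoc] at h₁ h₂ ⊢
      exact ldisj _ _ _ _ _ _ _ (hBΛ hΛ) h₁ h₂
    · have h₁ := h₁.weaken A 0
      have h₂ := h₂.weaken A 0
      rw [add_zero, add_comm, Multiset.add_cons] at h₁ h₂
      rw [Multiset.add_cons, add_left_comm]
      exact ldisj _ _ _ _ _ _ _ hΛ h₁ h₂
  | rdisj _ _ _ Δ₁ φ ψ h =>
    rcases cons_eq_cons_cases hΔ.symm with ⟨rfl, rfl⟩ | ⟨Θ, rfl, rfl⟩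
    · exact hdisj φ ψ rfl h
    · rw [Multiset.cons_swap ψ, Multiset.cons_swap φ] at h
      have := ih _ _ h
      simp only [Multiset.add_cons] at this ⊢
      exact rdisj _ _ _ _ _ _ this
  | lidisj _ _ Γ₁ _ χ a b h₁ h₂ =>
    subst hΔ
    have h₁ := ih _ _ h₁
    have h₂ := ih _ _ h₂
    simp only [Multiset.add_cons] at h₁ h₂ ⊢
    exact lidisj _ _ _ _ _ _ _ h₁ h₂
  | ridisjL _ _ _ Δ₁ χ a b h =>
    rcases cons_eq_cons_cases hΔ.symm with ⟨rfl, rfl⟩ | ⟨Θ, rfl, rfl⟩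
    · exact hchoose _ (splits_fill a b χ).left h
    · rw [Multiset.cons_swap] at h
      have := ih _ _ h
      simp only [Multiset.add_cons] at this ⊢
      exact ridisjL _ _ _ _ _ _ _ this
  | ridisjR _ _ _ Δ₁ χ a b h =>
    rcases cons_eq_cons_cases hΔ.symm with ⟨rfl, rfl⟩ | ⟨Θ, rfl, rfl⟩
    · exact hchoose _ (splits_fill a b χ).right h
    · rw [Multiset.cons_swap] at h
      have := ih _ _ h
      simp only [Multiset.add_cons] at this ⊢
      exact ridisjR _ _ _ _ _ _ _ this

theorem lneg_inv {n : ℕ} {Γ Δ : Multiset Form} {α : Form} (hα : α.IsClassical)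
    (h : GT false n (neg α ::ₘ Γ) Δ) : GT false n Γ (α ::ₘ Δ) := by
  induction n generalizing Γ Δ with
  | zero => nomatch h
  | succ n ih =>
    have := left_step (X := neg α) (A := 0) (B := {α}) (by simpa using hα)
      (fun _ _ h => by simpa using ih h) nofun nofun
      (by rintro _ ⟨⟩ h; simpa using h.height_succ) nofun nofun
      (fun _ _ hs => absurd hs not_splits_neg) h
    simpa using this

theorem rneg_inv {n : ℕ} {Γ Δ : Multiset Form} {α : Form}
    (h : GT false n Γ (neg α ::ₘ Δ)) : GT false n (α ::ₘ Γ) Δ := by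
  induction n generalizing Γ Δ with
  | zero => nomatch h
  | succ n ih =>
    have := right_step (X := neg α) (A := {α}) (B := 0) (by simp)
      (fun _ _ h => by simpa using ih h) nofun
      (by rintro _ ⟨⟩ h; simpa using h.height_succ) nofun nofun
      (fun _ hs => absurd hs not_chooses_neg) h
    simpa using this

theorem lconj_inv {n : ℕ} {Γ Δ : Multiset Form} {φ ψ : Form}
    (h : GT false n (conj φ ψ ::ₘ Γ) Δ) : GT false n (φ ::ₘ ψ ::ₘ Γ) Δ := by
  induction n generalizing Γ Δ φ ψ with
  | zero => nomatch h
  | succ n ih =>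
    have := left_step (X := conj φ ψ) (A := {φ, ψ}) (B := 0) (by simp)
      (fun _ _ h => by simpa using ih h) nofun nofun nofun
      (by rintro _ _ ⟨⟩ h; simpa using h.height_succ) nofun
      (by
        intro Y Z hs h₁ h₂
        simp only [Multiset.insert_eq_cons, Multiset.cons_add, Multiset.singleton_add, zero_add]
        cases hs with
        | conjL _ hs => exact left_of_splits hs (ih h₁) (ih h₂)
        | conjR _ hs =>
          have h₁ := ih h₁
          have h₂ := ih h₂
          rw [Multiset.cons_swap] at h₁ h₂ ⊢
          exact left_of_splits hs h₁ h₂) h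
    simpa using this

theorem rconj_inv_left {n : ℕ} {Γ Δ : Multiset Form} {φ ψ : Form}
    (h : GT false n Γ (conj φ ψ ::ₘ Δ)) : GT false n Γ (φ ::ₘ Δ) := by
  induction n generalizing Γ Δ φ ψ with
  | zero => nomatch h
  | succ n ih =>
    have := right_step (X := conj φ ψ) (A := 0) (B := {φ}) (fun hc => by simpa using hc.1)
      (fun _ _ h => by simpa using ih h) nofun nofun
      (by
        rintro _ _ Λ Θ ⟨⟩ rfl h _
        simpa using (h.weaken 0 Θ).height_succ) nofun
      (by
        intro Y hs h
        simp only [Multiset.singleton_add, zero_add]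
        rcases hs.conj_inv with ⟨φ', hs', rfl⟩ | ⟨ψ', hs', rfl⟩
        · exact right_of_chooses hs' (ih h)
        · exact (ih h).height_succ) h
    simpa using this

theorem rconj_inv_right {n : ℕ} {Γ Δ : Multiset Form} {φ ψ : Form}
    (h : GT false n Γ (conj φ ψ ::ₘ Δ)) : GT false n Γ (ψ ::ₘ Δ) := by
  induction n generalizing Γ Δ φ ψ with
  | zero => nomatch h
  | succ n ih =>
    have := right_step (X := conj φ ψ) (A := 0) (B := {ψ}) (fun hc => by simpa using hc.2)
      (fun _ _ h => by simpa using ih h) nofun nofun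
      (by
        rintro _ _ Λ Θ ⟨⟩ rfl _ h
        simpa using (h.weaken 0 Θ).height_succ) nofun
      (by
        intro Y hs h
        simp only [Multiset.singleton_add, zero_add]
        rcases hs.conj_inv with ⟨φ', hs', rfl⟩ | ⟨ψ', hs', rfl⟩
        · exact (ih h).height_succ
        · exact right_of_chooses hs' (ih h)) h
    simpa using this

theorem ldisj_inv_left {n : ℕ} {Γ Δ : Multiset Form} {φ ψ : Form}
    (h : GT false n (disj φ ψ ::ₘ Γ) Δ) : GT false n (φ ::ₘ Γ) Δ := by
  induction n generalizing Γ Δ φ ψ with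
  | zero => nomatch h
  | succ n ih =>
    have := left_step (X := disj φ ψ) (A := {φ}) (B := 0) (by simp)
      (fun _ _ h => by simpa using ih h) nofun nofun nofun nofun
      (by
        rintro _ _ Λ Θ ⟨⟩ rfl _ h _
        simpa using (h.weaken 0 Θ).height_succ)
      (by
        intro Y Z hs h₁ h₂
        simp only [Multiset.singleton_add, zero_add]
        cases hs with
        | disjL _ hs => exact left_of_splits hs (ih h₁) (ih h₂)
        | disjR _ hs => exact (ih h₁).height_succ) h
    simpa using this

theorem ldisj_inv_right {n : ℕ} {Γ Δ : Multiset Form} {φ ψ : Form}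
    (h : GT false n (disj φ ψ ::ₘ Γ) Δ) : GT false n (ψ ::ₘ Γ) Δ := by
  induction n generalizing Γ Δ φ ψ with
  | zero => nomatch h
  | succ n ih =>
    have := left_step (X := disj φ ψ) (A := {ψ}) (B := 0) (by simp)
      (fun _ _ h => by simpa using ih h) nofun nofun nofun nofun
      (by
        rintro _ _ Λ Θ ⟨⟩ rfl _ _ h
        simpa using (h.weaken 0 Θ).height_succ)
      (by
        intro Y Z hs h₁ h₂
        simp only [Multiset.singleton_add, zero_add]
        cases hs with
        | disjL _ hs => exact (ih h₁).height_succ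
        | disjR _ hs => exact left_of_splits hs (ih h₁) (ih h₂)) h
    simpa using this

theorem rdisj_inv {n : ℕ} {Γ Δ : Multiset Form} {φ ψ : Form}
    (h : GT false n Γ (disj φ ψ ::ₘ Δ)) : GT false n Γ (φ ::ₘ ψ ::ₘ Δ) := by
  induction n generalizing Γ Δ φ ψ with
  | zero => nomatch h
  | succ n ih =>
    have := right_step (X := disj φ ψ) (A := 0) (B := {φ, ψ}) (fun hc => by simpa using ⟨hc.1, hc.2⟩)
      (fun _ _ h => by simpa using ih h) nofun nofun nofun
      (by rintro _ _ ⟨⟩ h; simpa using h.height_succ)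
      (by
        intro Y hs h
        simp only [Multiset.insert_eq_cons, Multiset.cons_add, Multiset.singleton_add, zero_add]
        rcases hs.disj_inv with ⟨φ', hs', rfl⟩ | ⟨ψ', hs', rfl⟩
        · exact right_of_chooses hs' (ih h)
        · have h := ih h
          rw [Multiset.cons_swap] at h ⊢
          exact right_of_chooses hs' h) h
    simpa using this

theorem left_of_chooses {n : ℕ} {Γ Δ : Multiset Form} {X T : Form} (hT : Chooses X T)
    (h : GT false n (X ::ₘ Γ) Δ) : GT false n (T ::ₘ Γ) Δ := by
  induction n generalizing Γ Δ X T with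
  | zero => nomatch h
  | succ n ih =>
    have ih' {A B : Form} {Γ Δ : Multiset Form} (hr : Relation.ReflGen Chooses A B)
        (h : GT false n (A ::ₘ Γ) Δ) : GT false n (B ::ₘ Γ) Δ := by
      cases hr with
      | refl => exact h
      | single hr => exact ih hr h
    have := left_step (X := X) (A := {T}) (B := 0) (by simp)
      (fun _ _ h => by simpa using ih hT h)
      (by rintro p rfl; obtain ⟨_, h | h⟩ := hT <;> cases h)
      (by rintro rfl; obtain ⟨_, h | h⟩ := hT <;> cases h)
      (by rintro α rfl; exact absurd hT not_chooses_neg)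
      (by
        rintro φ ψ rfl h
        simp only [Multiset.singleton_add, zero_add]
        rcases hT.conj_inv with ⟨φ', hs, rfl⟩ | ⟨ψ', hs, rfl⟩
        · exact lconj _ _ _ _ _ _ (ih hs h)
        · rw [Multiset.cons_swap] at h
          have h := ih hs h
          rw [Multiset.cons_swap] at h
          exact lconj _ _ _ _ _ _ h)
      (by
        rintro φ ψ Λ Θ rfl rfl hΛ h₁ h₂
        simp only [Multiset.singleton_add, zero_add]
        rcases hT.disj_inv with ⟨φ', hs, rfl⟩ | ⟨ψ', hs, rfl⟩
        · exact ldisj _ _ _ _ _ _ _ hΛ (ih hs h₁) h₂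
        · exact ldisj _ _ _ _ _ _ _ hΛ h₁ (ih hs h₂))
      (by
        intro Y Z hs h₁ h₂
        simp only [Multiset.singleton_add, zero_add]
        have hj : Joins T Y Z := by
          obtain ⟨_, hT | hT⟩ := hT
          · exact (hT.joins hs).1
          · exact (hT.joins hs).2
        rcases hj with hr | hr | ⟨T₁, T₂, hs, hr₁, hr₂⟩
        · exact (ih' hr h₁).height_succ
        · exact (ih' hr h₂).height_succ
        · exact left_of_splits hs (ih' hr₁ h₁) (ih' hr₂ h₂)) h
    simpa using this

end GT

/-- Height-preserving inversion for GT⁻: the rules L¬, R¬,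
L∧, R∧, L∨, R∨ and L∨∨ are height-preserving invertible. -/
theorem hp_inversion :
    (∀ (n : ℕ) (Γ Δ : Multiset Form) (α : Form),
      (∀ φ ∈ Γ, Form.WF φ) → (∀ φ ∈ Δ, Form.WF φ) → Form.IsClassical α →
      GT false n (Form.neg α ::ₘ Γ) Δ → GT false n Γ (α ::ₘ Δ)) ∧
    (∀ (n : ℕ) (Γ Δ : Multiset Form) (α : Form),
      (∀ φ ∈ Γ, Form.WF φ) → (∀ φ ∈ Δ, Form.WF φ) → Form.IsClassical α →
      GT false n Γ (Form.neg α ::ₘ Δ) → GT false n (α ::ₘ Γ) Δ) ∧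
    (∀ (n : ℕ) (Γ Δ : Multiset Form) (φ ψ : Form),
      (∀ η ∈ Γ, Form.WF η) → (∀ η ∈ Δ, Form.WF η) → φ.WF → ψ.WF →
      GT false n (Form.conj φ ψ ::ₘ Γ) Δ → GT false n (φ ::ₘ ψ ::ₘ Γ) Δ) ∧
    (∀ (n : ℕ) (Γ Δ : Multiset Form) (φ ψ : Form),
      (∀ η ∈ Γ, Form.WF η) → (∀ η ∈ Δ, Form.WF η) → φ.WF → ψ.WF →
      GT false n Γ (Form.conj φ ψ ::ₘ Δ) →
      GT false n Γ (φ ::ₘ Δ) ∧ GT false n Γ (ψ ::ₘ Δ)) ∧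
    (∀ (n : ℕ) (Γ Δ : Multiset Form) (φ ψ : Form),
      (∀ η ∈ Γ, Form.WF η) → (∀ η ∈ Δ, Form.WF η) → φ.WF → ψ.WF →
      GT false n (Form.disj φ ψ ::ₘ Γ) Δ →
      GT false n (φ ::ₘ Γ) Δ ∧ GT false n (ψ ::ₘ Γ) Δ) ∧
    (∀ (n : ℕ) (Γ Δ : Multiset Form) (φ ψ : Form),
      (∀ η ∈ Γ, Form.WF η) → (∀ η ∈ Δ, Form.WF η) → φ.WF → ψ.WF →
      GT false n Γ (Form.disj φ ψ ::ₘ Δ) → GT false n Γ (φ ::ₘ ψ ::ₘ Δ)) ∧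
    (∀ (n : ℕ) (Γ Δ : Multiset Form) (χ : Ctx) (φL φR : Form),
      (∀ η ∈ Γ, Form.WF η) → (∀ η ∈ Δ, Form.WF η) →
      (χ.fill (Form.idisj φL φR)).WF →
      GT false n (χ.fill (Form.idisj φL φR) ::ₘ Γ) Δ →
      GT false n (χ.fill φL ::ₘ Γ) Δ ∧ GT false n (χ.fill φR ::ₘ Γ) Δ) := by
  refine ⟨fun _ _ _ _ _ _ hα h => GT.lneg_inv hα h, fun _ _ _ _ _ _ _ h => h.rneg_inv,
    fun _ _ _ _ _ _ _ _ _ h => h.lconj_inv,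
    fun _ _ _ _ _ _ _ _ _ h => ⟨h.rconj_inv_left, h.rconj_inv_right⟩,
    fun _ _ _ _ _ _ _ _ _ h => ⟨h.ldisj_inv_left, h.ldisj_inv_right⟩,
    fun _ _ _ _ _ _ _ _ _ h => h.rdisj_inv, fun _ _ _ χ φL φR _ _ _ h => ?_⟩
  exact ⟨GT.left_of_chooses (Form.splits_fill φL φR χ).left h,
    GT.left_of_chooses (Form.splits_fill φL φR χ).right h⟩
end

section
/- Height-preserving split-style inversion for R∨∨ in GT⁻: if Ξ is a multiset of classical formulas and Ξ ⇒ χ{φ_L∨∨φ_R},Δ has a GT⁻-derivation of height at most n, then Ξ ⇒ χ{φ_L},Δ has a GT⁻-derivation of height at most n or Ξ ⇒ χ{φ_R},Δ has a GT⁻-derivation of height at most n. -/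
/-- `Form.Step φ ψ`: `ψ` arises from `φ` by replacing one inquisitive disjunction
that is not in the scope of a negation by one of its disjuncts. -/
inductive Form.Step : Form → Form → Prop
  | left (φ ψ : Form) : Step (Form.idisj φ ψ) φ
  | right (φ ψ : Form) : Step (Form.idisj φ ψ) ψ
  | conjL {φ φ' : Form} (ψ : Form) : Step φ φ' → Step (Form.conj φ ψ) (Form.conj φ' ψ)
  | conjR {φ φ' : Form} (ψ : Form) : Step φ φ' → Step (Form.conj ψ φ) (Form.conj ψ φ')
  | disjL {φ φ' : Form} (ψ : Form) : Step φ φ' → Step (Form.disj φ ψ) (Form.disj φ' ψ)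
  | disjR {φ φ' : Form} (ψ : Form) : Step φ φ' → Step (Form.disj ψ φ) (Form.disj ψ φ')
  | idisjL {φ φ' : Form} (ψ : Form) : Step φ φ' → Step (Form.idisj φ ψ) (Form.idisj φ' ψ)
  | idisjR {φ φ' : Form} (ψ : Form) : Step φ φ' → Step (Form.idisj ψ φ) (Form.idisj ψ φ')

theorem Form.Step.fill {φ ψ : Form} (h : Form.Step φ ψ) :
    ∀ χ : Ctx, Form.Step (χ.fill φ) (χ.fill ψ)
  | .hole => h
  | .conjL c θ => .conjL θ (h.fill c)
  | .conjR θ c => .conjR θ (h.fill c)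
  | .disjL c θ => .disjL θ (h.fill c)
  | .disjR θ c => .disjR θ (h.fill c)
  | .idisjL c θ => .idisjL θ (h.fill c)
  | .idisjR θ c => .idisjR θ (h.fill c)

theorem Form.Step.exists_ctx {φ ψ : Form} (h : Form.Step φ ψ) :
    ∃ (χ : Ctx) (a b : Form), φ = χ.fill (Form.idisj a b) ∧ (ψ = χ.fill a ∨ ψ = χ.fill b) := by
  induction h with
  | left φ ψ => exact ⟨.hole, φ, ψ, rfl, .inl rfl⟩
  | right φ ψ => exact ⟨.hole, φ, ψ, rfl, .inr rfl⟩
  | conjL θ _ ih =>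
    obtain ⟨χ, a, b, rfl, rfl | rfl⟩ := ih
    exacts [⟨.conjL χ θ, a, b, rfl, .inl rfl⟩, ⟨.conjL χ θ, a, b, rfl, .inr rfl⟩]
  | conjR θ _ ih =>
    obtain ⟨χ, a, b, rfl, rfl | rfl⟩ := ih
    exacts [⟨.conjR θ χ, a, b, rfl, .inl rfl⟩, ⟨.conjR θ χ, a, b, rfl, .inr rfl⟩]
  | disjL θ _ ih =>
    obtain ⟨χ, a, b, rfl, rfl | rfl⟩ := ih
    exacts [⟨.disjL χ θ, a, b, rfl, .inl rfl⟩, ⟨.disjL χ θ, a, b, rfl, .inr rfl⟩]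
  | disjR θ _ ih =>
    obtain ⟨χ, a, b, rfl, rfl | rfl⟩ := ih
    exacts [⟨.disjR θ χ, a, b, rfl, .inl rfl⟩, ⟨.disjR θ χ, a, b, rfl, .inr rfl⟩]
  | idisjL θ _ ih =>
    obtain ⟨χ, a, b, rfl, rfl | rfl⟩ := ih
    exacts [⟨.idisjL χ θ, a, b, rfl, .inl rfl⟩, ⟨.idisjL χ θ, a, b, rfl, .inr rfl⟩]
  | idisjR θ _ ih =>
    obtain ⟨χ, a, b, rfl, rfl | rfl⟩ := ih
    exacts [⟨.idisjR θ χ, a, b, rfl, .inl rfl⟩, ⟨.idisjR θ χ, a, b, rfl, .inr rfl⟩]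

/-- Commutation of a step in `χ{l ∨∨ r}` with the choice of a disjunct of the displayed
inquisitive disjunction: either the step makes or discards that choice, or the disjunction
survives and the choice can be made afterwards. -/
theorem Ctx.step_fill_idisj (χ : Ctx) (l r G : Form)
    (h : Form.Step (χ.fill (Form.idisj l r)) G) :
    (∃ (χ' : Ctx) (l' r' : Form), G = χ'.fill (Form.idisj l' r') ∧
      Relation.ReflGen Form.Step (χ.fill l) (χ'.fill l') ∧
      Relation.ReflGen Form.Step (χ.fill r) (χ'.fill r')) ∨
    Relation.ReflGen Form.Step (χ.fill l) G ∨ Relation.ReflGen Form.Step (χ.fill r) G := by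
  have lift : ∀ (c : Ctx) {φ ψ : Form}, Relation.ReflGen Form.Step φ ψ →
      Relation.ReflGen Form.Step (c.fill φ) (c.fill ψ) := by
    rintro c φ ψ (_ | h)
    exacts [.refl, .single (h.fill c)]
  induction χ generalizing G with
  | hole =>
    cases h with
    | left => exact .inr (.inl .refl)
    | right => exact .inr (.inr .refl)
    | idisjL _ h => exact .inl ⟨.hole, _, _, rfl, .single h, .refl⟩
    | idisjR _ h => exact .inl ⟨.hole, _, _, rfl, .refl, .single h⟩
  | conjL c θ ih =>
    cases h with
    | conjL _ h =>
      obtain ⟨χ', l', r', rfl, h₁, h₂⟩ | h | h := ih _ h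
      exacts [.inl ⟨.conjL χ' θ, l', r', rfl, lift (.conjL .hole θ) h₁, lift (.conjL .hole θ) h₂⟩,
        .inr (.inl (lift (.conjL .hole θ) h)), .inr (.inr (lift (.conjL .hole θ) h))]
    | conjR _ h => exact .inl ⟨.conjL c _, l, r, rfl, .single (.conjR _ h), .single (.conjR _ h)⟩
  | conjR θ c ih =>
    cases h with
    | conjR _ h =>
      obtain ⟨χ', l', r', rfl, h₁, h₂⟩ | h | h := ih _ h
      exacts [.inl ⟨.conjR θ χ', l', r', rfl, lift (.conjR θ .hole) h₁, lift (.conjR θ .hole) h₂⟩,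
        .inr (.inl (lift (.conjR θ .hole) h)), .inr (.inr (lift (.conjR θ .hole) h))]
    | conjL _ h => exact .inl ⟨.conjR _ c, l, r, rfl, .single (.conjL _ h), .single (.conjL _ h)⟩
  | disjL c θ ih =>
    cases h with
    | disjL _ h =>
      obtain ⟨χ', l', r', rfl, h₁, h₂⟩ | h | h := ih _ h
      exacts [.inl ⟨.disjL χ' θ, l', r', rfl, lift (.disjL .hole θ) h₁, lift (.disjL .hole θ) h₂⟩,
        .inr (.inl (lift (.disjL .hole θ) h)), .inr (.inr (lift (.disjL .hole θ) h))]
    | disjR _ h => exact .inl ⟨.disjL c _, l, r, rfl, .single (.disjR _ h), .single (.disjR _ h)⟩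
  | disjR θ c ih =>
    cases h with
    | disjR _ h =>
      obtain ⟨χ', l', r', rfl, h₁, h₂⟩ | h | h := ih _ h
      exacts [.inl ⟨.disjR θ χ', l', r', rfl, lift (.disjR θ .hole) h₁, lift (.disjR θ .hole) h₂⟩,
        .inr (.inl (lift (.disjR θ .hole) h)), .inr (.inr (lift (.disjR θ .hole) h))]
    | disjL _ h => exact .inl ⟨.disjR _ c, l, r, rfl, .single (.disjL _ h), .single (.disjL _ h)⟩
  | idisjL c θ ih =>
    cases h with
    | left => exact .inl ⟨c, l, r, rfl, .single (.left _ _), .single (.left _ _)⟩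
    | right => exact .inr (.inl (.single (.right _ _)))
    | idisjL _ h =>
      obtain ⟨χ', l', r', rfl, h₁, h₂⟩ | h | h := ih _ h
      exacts [.inl ⟨.idisjL χ' θ, l', r', rfl, lift (.idisjL .hole θ) h₁,
          lift (.idisjL .hole θ) h₂⟩,
        .inr (.inl (lift (.idisjL .hole θ) h)), .inr (.inr (lift (.idisjL .hole θ) h))]
    | idisjR _ h =>
      exact .inl ⟨.idisjL c _, l, r, rfl, .single (.idisjR _ h), .single (.idisjR _ h)⟩
  | idisjR θ c ih =>
    cases h with
    | left => exact .inr (.inl (.single (.left _ _)))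
    | right => exact .inl ⟨c, l, r, rfl, .single (.right _ _), .single (.right _ _)⟩
    | idisjR _ h =>
      obtain ⟨χ', l', r', rfl, h₁, h₂⟩ | h | h := ih _ h
      exacts [.inl ⟨.idisjR θ χ', l', r', rfl, lift (.idisjR θ .hole) h₁,
          lift (.idisjR θ .hole) h₂⟩,
        .inr (.inl (lift (.idisjR θ .hole) h)), .inr (.inr (lift (.idisjR θ .hole) h))]
    | idisjL _ h =>
      exact .inl ⟨.idisjR _ c, l, r, rfl, .single (.idisjL _ h), .single (.idisjL _ h)⟩

theorem Ctx.not_isClassical_fill_idisj (l r : Form) :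
    ∀ χ : Ctx, ¬ (χ.fill (Form.idisj l r)).IsClassical
  | .hole => id
  | .conjL c _ => fun h => not_isClassical_fill_idisj l r c h.1
  | .conjR _ c => fun h => not_isClassical_fill_idisj l r c h.2
  | .disjL c _ => fun h => not_isClassical_fill_idisj l r c h.1
  | .disjR _ c => fun h => not_isClassical_fill_idisj l r c h.2
  | .idisjL _ _ => id
  | .idisjR _ _ => id

theorem GT.succ {c : Bool} {n : ℕ} {Γ Δ : Multiset Form} (h : GT c n Γ Δ) :
    GT c (n + 1) Γ Δ := by
  induction h with
  | ax => exact .ax ..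
  | lbot => exact .lbot ..
  | lneg _ _ _ _ _ hα _ ih => exact .lneg _ _ _ _ _ hα ih
  | rneg _ _ _ _ _ hα _ ih => exact .rneg _ _ _ _ _ hα ih
  | lconj _ _ _ _ _ _ _ ih => exact .lconj _ _ _ _ _ _ ih
  | rconj _ _ _ _ _ _ _ hΛ _ _ ih₁ ih₂ => exact .rconj _ _ _ _ _ _ _ hΛ ih₁ ih₂
  | ldisj _ _ _ _ _ _ _ hΛ _ _ ih₁ ih₂ => exact .ldisj _ _ _ _ _ _ _ hΛ ih₁ ih₂
  | rdisj _ _ _ _ _ _ _ ih => exact .rdisj _ _ _ _ _ _ ih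
  | lidisj _ _ _ _ _ _ _ _ _ ih₁ ih₂ => exact .lidisj _ _ _ _ _ _ _ ih₁ ih₂
  | ridisjL _ _ _ _ _ _ _ _ ih => exact .ridisjL _ _ _ _ _ _ _ ih
  | ridisjR _ _ _ _ _ _ _ _ ih => exact .ridisjR _ _ _ _ _ _ _ ih
  | cut _ _ _ _ _ _ _ _ ih₁ ih₂ => exact .cut _ _ _ _ _ _ ih₁ ih₂

theorem GT.of_step {c : Bool} {n : ℕ} {Γ Δ : Multiset Form} {φ ψ : Form}
    (hs : Form.Step φ ψ) (h : GT c n Γ (ψ ::ₘ Δ)) : GT c (n + 1) Γ (φ ::ₘ Δ) := by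
  obtain ⟨χ, a, b, rfl, rfl | rfl⟩ := hs.exists_ctx
  exacts [.ridisjL _ _ _ _ _ _ _ h, .ridisjR _ _ _ _ _ _ _ h]

theorem GT.of_reflGen_step {c : Bool} {n : ℕ} {Γ Δ : Multiset Form} {φ ψ : Form}
    (hs : Relation.ReflGen Form.Step φ ψ) (h : GT c n Γ (ψ ::ₘ Δ)) :
    GT c (n + 1) Γ (φ ::ₘ Δ) := by
  cases hs with
  | refl => exact h.succ
  | single hs => exact h.of_step hs

/-- In a multiset `Λ + Δ` with `Λ` classical, a displayed formula with an inquisitive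
disjunction lies in `Δ`. -/
theorem Ctx.exists_cons_of_fill_cons_eq_add {Λ Δ Δ' : Multiset Form} {χ : Ctx} {l r : Form}
    (hΛ : ∀ γ ∈ Λ, Form.IsClassical γ)
    (h : Λ + Δ = χ.fill (Form.idisj l r) ::ₘ Δ') :
    ∃ Θ : Multiset Form, Δ = χ.fill (Form.idisj l r) ::ₘ Θ ∧ Δ' = Λ + Θ := by
  have hmem : χ.fill (Form.idisj l r) ∈ Λ + Δ := h ▸ Multiset.mem_cons_self _ _
  obtain hm | hm := Multiset.mem_add.1 hmem
  · exact (Ctx.not_isClassical_fill_idisj l r χ (hΛ _ hm)).elim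
  · obtain ⟨Θ, rfl⟩ := Multiset.exists_cons_of_mem hm
    rw [Multiset.add_cons] at h
    exact ⟨Θ, rfl, ((Multiset.cons_inj_right _).1 h).symm⟩

/-- Split-style inversion for a succedent whose last inference is a deep right rule for the
inquisitive disjunction, given inversion for its premise. -/
theorem GT.split_inversion_of_step {n : ℕ} {Γ Δ Δ' : Multiset Form} {χ : Ctx}
    {l r φ ψ : Form} (hs : Form.Step φ ψ) (hp : GT false n Γ (ψ ::ₘ Δ))
    (ih : ∀ (χ : Ctx) (l r : Form) (Δ' : Multiset Form),
      ψ ::ₘ Δ = χ.fill (Form.idisj l r) ::ₘ Δ' →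
      GT false n Γ (χ.fill l ::ₘ Δ') ∨ GT false n Γ (χ.fill r ::ₘ Δ'))
    (he : φ ::ₘ Δ = χ.fill (Form.idisj l r) ::ₘ Δ') :
    GT false (n + 1) Γ (χ.fill l ::ₘ Δ') ∨ GT false (n + 1) Γ (χ.fill r ::ₘ Δ') := by
  obtain ⟨rfl, rfl⟩ | ⟨_, Θ, rfl, rfl⟩ := Multiset.cons_eq_cons.1 he
  · obtain ⟨χ', l', r', rfl, h₁, h₂⟩ | h | h := Ctx.step_fill_idisj _ _ _ _ hs
    · exact (ih χ' l' r' Δ rfl).imp (GT.of_reflGen_step h₁) (GT.of_reflGen_step h₂)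
    · exact .inl (hp.of_reflGen_step h)
    · exact .inr (hp.of_reflGen_step h)
  · rw [Multiset.cons_swap _ φ, Multiset.cons_swap _ φ]
    refine (ih χ l r (ψ ::ₘ Θ) (Multiset.cons_swap ..)).imp (fun h => ?_) (fun h => ?_)
    all_goals
      rw [Multiset.cons_swap] at h
      exact h.of_step hs

theorem GT.split_inversion {c : Bool} {n : ℕ} {Γ Θ : Multiset Form} (h : GT c n Γ Θ)
    (hc : c = false) (hΓ : ∀ α ∈ Γ, Form.IsClassical α) (χ : Ctx) (l r : Form)
    (Δ : Multiset Form) (he : Θ = χ.fill (Form.idisj l r) ::ₘ Δ) :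
    GT false n Γ (χ.fill l ::ₘ Δ) ∨ GT false n Γ (χ.fill r ::ₘ Δ) := by
  induction h generalizing χ l r Δ with
  | ax c n Γ Δ₀ p =>
    obtain ⟨h, -⟩ | ⟨_, Θ, rfl, rfl⟩ := Multiset.cons_eq_cons.1 he
    · exact (Ctx.not_isClassical_fill_idisj l r χ (h ▸ trivial)).elim
    · left
      rw [Multiset.cons_swap]
      exact .ax ..
  | lbot => exact .inl (.lbot ..)
  | lneg c n Γ Δ₀ α hα _ ih =>
    subst he
    rw [Multiset.forall_mem_cons] at hΓ
    refine (ih hc hΓ.2 χ l r (α ::ₘ Δ) (Multiset.cons_swap ..)).imp ?_ ?_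
    all_goals exact fun h => .lneg _ _ _ _ _ hα (Multiset.cons_swap _ α _ ▸ h)
  | rneg c n Γ Δ₀ α hα _ ih =>
    obtain ⟨h, -⟩ | ⟨_, Θ, rfl, rfl⟩ := Multiset.cons_eq_cons.1 he
    · exact (Ctx.not_isClassical_fill_idisj l r χ (h ▸ hα)).elim
    · rw [Multiset.cons_swap _ (Form.neg α), Multiset.cons_swap _ (Form.neg α)]
      exact (ih hc (Multiset.forall_mem_cons.2 ⟨hα, hΓ⟩) χ l r Θ rfl).imp
        (.rneg _ _ _ _ _ hα) (.rneg _ _ _ _ _ hα)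
  | lconj c n Γ Δ₀ φ ψ _ ih =>
    rw [Multiset.forall_mem_cons] at hΓ
    exact (ih hc (Multiset.forall_mem_cons.2
      ⟨hΓ.1.1, Multiset.forall_mem_cons.2 ⟨hΓ.1.2, hΓ.2⟩⟩) χ l r Δ he).imp
      (.lconj _ _ _ _ _ _) (.lconj _ _ _ _ _ _)
  | rconj c n Γ Λ Δ₀ φ ψ hΛ h₁ h₂ ih₁ ih₂ =>
    subst hc
    obtain ⟨h, rfl⟩ | ⟨_, Θ, hΘ, rfl⟩ := Multiset.cons_eq_cons.1 he
    · cases χ with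
      | conjL χ θ =>
        cases h
        exact (ih₁ rfl hΓ χ l r Λ rfl).imp
          (fun h => .rconj _ _ _ _ _ _ _ hΛ h h₂) (fun h => .rconj _ _ _ _ _ _ _ hΛ h h₂)
      | conjR θ χ =>
        cases h
        exact (ih₂ rfl hΓ χ l r Λ rfl).imp
          (fun h => .rconj _ _ _ _ _ _ _ hΛ h₁ h) (fun h => .rconj _ _ _ _ _ _ _ hΛ h₁ h)
      | _ => cases h
    · obtain ⟨Ψ, rfl, rfl⟩ := Ctx.exists_cons_of_fill_cons_eq_add hΛ hΘ
      left
      rw [Multiset.cons_swap, ← Multiset.add_cons]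
      exact .rconj _ _ _ _ _ _ _ hΛ h₁ h₂
  | ldisj c n Γ Λ Δ₀ φ ψ hΛ h₁ h₂ =>
    subst hc
    obtain ⟨Ψ, rfl, rfl⟩ := Ctx.exists_cons_of_fill_cons_eq_add hΛ he
    left
    rw [← Multiset.add_cons]
    exact .ldisj _ _ _ _ _ _ _ hΛ h₁ h₂
  | rdisj c n Γ Δ₀ φ ψ _ ih =>
    obtain ⟨h, rfl⟩ | ⟨_, Θ, rfl, rfl⟩ := Multiset.cons_eq_cons.1 he
    · cases χ with
      | disjL χ θ =>
        cases h
        exact (ih hc hΓ χ l r _ rfl).imp (.rdisj _ _ _ _ _ _) (.rdisj _ _ _ _ _ _)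
      | disjR θ χ =>
        cases h
        refine (ih hc hΓ χ l r _ (Multiset.cons_swap ..)).imp ?_ ?_
        all_goals exact fun h => .rdisj _ _ _ _ _ _ (Multiset.cons_swap _ φ _ ▸ h)
      | _ => cases h
    · rw [Multiset.cons_swap _ (Form.disj φ ψ), Multiset.cons_swap _ (Form.disj φ ψ)]
      refine (ih hc hΓ χ l r (φ ::ₘ ψ ::ₘ Θ) ?_).imp (fun h => ?_) (fun h => ?_)
      · rw [Multiset.cons_swap ψ, Multiset.cons_swap φ]
      all_goals
        rw [Multiset.cons_swap _ φ, Multiset.cons_swap _ ψ] at h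
        exact .rdisj _ _ _ _ _ _ h
  | lidisj c n Γ Δ₀ χ' a b =>
    exact (Ctx.not_isClassical_fill_idisj a b χ' (hΓ _ (Multiset.mem_cons_self _ _))).elim
  | ridisjL c n Γ Δ₀ χ' a b hp ih =>
    subst hc
    exact GT.split_inversion_of_step ((Form.Step.left a b).fill χ') hp (ih rfl hΓ) he
  | ridisjR c n Γ Δ₀ χ' a b hp ih =>
    subst hc
    exact GT.split_inversion_of_step ((Form.Step.right a b).fill χ') hp (ih rfl hΓ) he
  | cut => cases hc

/-- Height-preserving split-style inversion for R∨∨ in GT⁻: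
with a classical antecedent Ξ, if ⊢ⁿ Ξ ⇒ χ{φ_L∨∨φ_R},Δ then
⊢ⁿ Ξ ⇒ χ{φ_L},Δ or ⊢ⁿ Ξ ⇒ χ{φ_R},Δ. -/
theorem hp_split_inversion (n : ℕ) (Ξ Δ : Multiset Form) (χ : Ctx)
    (φL φR : Form)
    (hΞ : ∀ α ∈ Ξ, Form.IsClassical α) (hΔ : ∀ φ ∈ Δ, Form.WF φ)
    (hχ : (χ.fill (Form.idisj φL φR)).WF)
    (h : GT false n Ξ (χ.fill (Form.idisj φL φR) ::ₘ Δ)) :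
    GT false n Ξ (χ.fill φL ::ₘ Δ) ∨ GT false n Ξ (χ.fill φR ::ₘ Δ) := by
  exact h.split_inversion rfl hΞ χ φL φR Δ rfl
end
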